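/- arXiv:1301.4819 — 3 statements merged into one kernel-verified Lean document; each statement's English description precedes it below -/
import Mathlib

section
/- Let s ∈ [0,∞) and p ∈ (0, Q/s). There is a constant C such that for every measurable u with s-Hajłasz gradient g, every x ∈ X and r > 0, inf_{c∈ℝ} ( ⨍_{B(x,r)} |u - c|^{p*(s)} dμ )^{1/p*(s)} ≤ C r^s ( ⨍_{B(x,2r)} g^p dμ )^{1/p}, where p*(s) = Qp/(Q - sp). -/
open MeasureTheory Metric ENNReal

namespace FracMaximal

variable {X : Type*}

/-- The measure `μ` is doubling with constant `c`. -/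
def IsDoubling [PseudoMetricSpace X] [MeasurableSpace X] (μ : Measure X) (c : ℝ≥0∞) : Prop :=
  ∀ (x : X) (r : ℝ), 0 < r → μ (ball x (2 * r)) ≤ c * μ (ball x r)

/-- Lower dimension bound: `μ(B(y,r))/μ(B(x,R)) ≥ c (r/R)^Q`. -/
def DimLowerBound [PseudoMetricSpace X] [MeasurableSpace X] (μ : Measure X) (c Q : ℝ) : Prop :=
  ∀ (x y : X) (r R : ℝ), 0 < r → r ≤ R → y ∈ ball x R →
    ENNReal.ofReal (c * (r / R) ^ Q) * μ (ball x R) ≤ μ (ball y r)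

/-- The fractional maximal function `M_α u(x) = sup_{r>0} r^α ⨍_{B(x,r)} |u| dμ`. -/
noncomputable def fracMax [PseudoMetricSpace X] [MeasurableSpace X] (μ : Measure X) (α : ℝ)
    (u : X → ℝ) (x : X) : ℝ≥0∞ :=
  ⨆ (r : ℝ) (_ : 0 < r), ENNReal.ofReal (r ^ α) * ⨍⁻ y in ball x r, ‖u y‖₊ ∂μ

/-- `g` is an `s`-Hajłasz gradient of `u`. -/
def IsHajlaszGradient [PseudoMetricSpace X] [MeasurableSpace X] (μ : Measure X) (s : ℝ)
    (u g : X → ℝ) : Prop :=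
  Measurable g ∧ (∀ x, 0 ≤ g x) ∧ ∃ E : Set X, μ E = 0 ∧
    ∀ x ∉ E, ∀ y ∉ E, |u x - u y| ≤ dist x y ^ s * (g x + g y)

/-- The homogeneous Hajłasz space (quasi)norm `‖u‖_{Ṁ^{s,p}}`. -/
noncomputable def hajlaszNorm [PseudoMetricSpace X] [MeasurableSpace X] (μ : Measure X)
    (s p : ℝ) (u : X → ℝ) : ℝ≥0∞ :=
  ⨅ (g : X → ℝ) (_ : IsHajlaszGradient μ s u g), eLpNorm g (ENNReal.ofReal p) μ

/-- `(g k)` is a fractional `s`-Hajłasz gradient of `u`. -/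
def IsFracHajlaszGradient [PseudoMetricSpace X] [MeasurableSpace X] (μ : Measure X) (s : ℝ)
    (u : X → ℝ) (g : ℤ → X → ℝ) : Prop :=
  (∀ k, Measurable (g k)) ∧ (∀ k x, 0 ≤ g k x) ∧ ∃ E : Set X, μ E = 0 ∧
    ∀ (k : ℤ), ∀ x ∉ E, ∀ y ∉ E,
      (2 : ℝ) ^ (-k - 1) ≤ dist x y → dist x y < (2 : ℝ) ^ (-k) →
        |u x - u y| ≤ dist x y ^ s * (g k x + g k y)

/-- Homogeneous Hajłasz--Triebel--Lizorkin (quasi)norm `‖u‖_{Ṁ^s_{p,q}}`. -/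
noncomputable def tlNorm [PseudoMetricSpace X] [MeasurableSpace X] (μ : Measure X)
    (s p q : ℝ) (u : X → ℝ) : ℝ≥0∞ :=
  ⨅ (g : ℤ → X → ℝ) (_ : IsFracHajlaszGradient μ s u g),
    (∫⁻ x, (∑' k : ℤ, ENNReal.ofReal (g k x ^ q)) ^ (p / q) ∂μ) ^ (1 / p)

/-- Homogeneous Hajłasz--Besov (quasi)norm `‖u‖_{Ṅ^s_{p,q}}`. -/
noncomputable def besovNorm [PseudoMetricSpace X] [MeasurableSpace X] (μ : Measure X)
    (s p q : ℝ) (u : X → ℝ) : ℝ≥0∞ :=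
  ⨅ (g : ℤ → X → ℝ) (_ : IsFracHajlaszGradient μ s u g),
    (∑' k : ℤ, (eLpNorm (g k) (ENNReal.ofReal p) μ) ^ q) ^ (1 / q)

/-- Data for the discrete (fractional) maximal operator: for each positive rational scale `r`,
a covering of `X` by balls `B(x_i, r)` whose dilations `B(x_i, 6r)` have bounded overlap,
together with a Lipschitz partition of unity subordinate to the covering. -/
structure DiscreteMaxData (X : Type*) [PseudoMetricSpace X] where
  center : ℚ → ℕ → X
  φ : ℚ → ℕ → X → ℝ
  N : ℕ
  ν : ℝ
  L : ℝ
  ν_pos : 0 < ν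
  L_pos : 0 < L
  cover : ∀ r : ℚ, 0 < r → ∀ x : X, ∃ i, x ∈ ball (center r i) (r : ℝ)
  overlap : ∀ r : ℚ, 0 < r → ∀ x : X,
    ∑' i : ℕ, (ball (center r i) (6 * (r : ℝ))).indicator (fun _ => (1 : ℝ≥0∞)) x ≤ N
  φ_nonneg : ∀ r i x, 0 ≤ φ r i x
  φ_le_one : ∀ r i x, φ r i x ≤ 1
  φ_supp : ∀ r : ℚ, 0 < r → ∀ i x, x ∉ ball (center r i) (6 * (r : ℝ)) → φ r i x = 0
  φ_lower : ∀ r : ℚ, 0 < r → ∀ i x, x ∈ ball (center r i) (3 * (r : ℝ)) → ν ≤ φ r i x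
  φ_lip : ∀ r : ℚ, 0 < r → ∀ i, LipschitzWith (Real.toNNReal (L / (r : ℝ))) (φ r i)
  φ_sum : ∀ r : ℚ, 0 < r → ∀ x, ∑' i, φ r i x = 1

/-- The discrete fractional maximal function `M*_α u = sup_j r_j^α |u|_{r_j}`, where
`|u|_r(x) = Σ_i φ_i(x) ⨍_{B(x_i,3r)} |u| dμ` is the discrete convolution at scale `3r`. -/
noncomputable def DiscreteMaxData.dMax [PseudoMetricSpace X] [MeasurableSpace X]
    (D : DiscreteMaxData X) (μ : Measure X) (α : ℝ) (u : X → ℝ) (x : X) : ℝ≥0∞ :=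
  ⨆ (r : ℚ) (_ : 0 < r), ENNReal.ofReal ((r : ℝ) ^ α) *
    ∑' i : ℕ, ENNReal.ofReal (D.φ r i x) *
      ⨍⁻ y in ball (D.center r i) (3 * (r : ℝ)), ‖u y‖₊ ∂μ

/-- In a ball of large measure, some point outside a given null set has a small value of `g`. -/
theorem DimLowerBound.exists_mem_ball_le [PseudoMetricSpace X] [MeasurableSpace X]
    {μ : Measure X} {c Q : ℝ} (hdim : DimLowerBound μ c Q) {g : X → ℝ} (hg : Measurable g)
    {p : ℝ} (hp : 0 < p) {x y : X} {ρ R a l : ℝ} (hρ : 0 < ρ) (hl : 0 < l)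
    (hyR : dist y x + ρ ≤ R) (h0 : μ (ball x R) ≠ 0) (htop : μ (ball x R) ≠ ∞)
    (hint : ∫⁻ z in ball x R, ENNReal.ofReal (g z ^ p) ∂μ ≤ ENNReal.ofReal a * μ (ball x R))
    (ha : 0 ≤ a) (hal : a < l ^ p * (c * (ρ / R) ^ Q)) {N : Set X} (hN : μ N = 0) :
    ∃ z ∈ ball y ρ, z ∉ N ∧ g z ≤ l := by
  by_contra! hcon
  have hdist : 0 ≤ dist y x := dist_nonneg
  have hsub : ball y ρ ⊆
      N ∪ ({z | ENNReal.ofReal (l ^ p) ≤ ENNReal.ofReal (g z ^ p)} ∩ ball x R) := by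
    intro z hz
    by_cases hzN : z ∈ N
    · exact Or.inl hzN
    · refine Or.inr ⟨ENNReal.ofReal_le_ofReal ?_, ?_⟩
      · exact Real.rpow_le_rpow hl.le (hcon z hz hzN).le hp.le
      · exact ball_subset_ball' (by linarith) hz
  have hmeas : Measurable fun z => ENNReal.ofReal (g z ^ p) := (hg.pow_const p).ennreal_ofReal
  have hball : μ (ball y ρ) ≤
      μ.restrict (ball x R) {z | ENNReal.ofReal (l ^ p) ≤ ENNReal.ofReal (g z ^ p)} := by
    rw [Measure.restrict_apply (measurableSet_le measurable_const hmeas)]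
    refine (measure_mono hsub).trans ((measure_union_le _ _).trans ?_)
    rw [hN, zero_add]
  have hle : ENNReal.ofReal (l ^ p * (c * (ρ / R) ^ Q)) * μ (ball x R) ≤
      ENNReal.ofReal a * μ (ball x R) := by
    rw [ENNReal.ofReal_mul (by positivity), mul_assoc]
    have hd := hdim x y ρ R hρ (by linarith) (mem_ball.2 (by linarith))
    calc _ ≤ ENNReal.ofReal (l ^ p) *
          μ.restrict (ball x R) {z | ENNReal.ofReal (l ^ p) ≤ ENNReal.ofReal (g z ^ p)} := by
          gcongr; exact hd.trans hball
      _ ≤ _ := (mul_meas_ge_le_lintegral hmeas _).trans hint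
  rw [ENNReal.mul_le_mul_iff_left h0 htop, ENNReal.ofReal_le_ofReal_iff ha] at hle
  linarith

/-- Telescoping along a chain of points on which `g` is halved at every step. -/
theorem exists_chain_end [PseudoMetricSpace X] {s : ℝ} (hs : 0 ≤ s) {u g : X → ℝ} {N : Set X}
    (hgrad : ∀ y ∉ N, ∀ z ∉ N, |u y - u z| ≤ dist y z ^ s * (g y + g z))
    {x : X} {r q τ : ℝ} (hr : 0 < r) (hq : 0 < q) (hτ : 0 < τ)
    (hb : 1 < 2 * q ^ s)
    (hstep : ∀ (n : ℕ) (y : X), dist y x < r + r * q ^ (n + 1) →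
      ∃ z ∈ ball y ((1 - q) * q ^ n * r), z ∉ N ∧ g z ≤ 2 ^ n * τ)
    (n : ℕ) (y : X) (hyN : y ∉ N) (hyx : dist y x < r + r * q ^ n) (hgy : g y ≤ 2 ^ n * τ) :
    ∃ z ∉ N, dist z x < 2 * r ∧ g z ≤ τ ∧
      |u y - u z| ≤ 3 * τ * r ^ s / (2 * q ^ s - 1) * (2 * q ^ s) ^ n := by
  have hb' : 0 < 2 * q ^ s - 1 := by linarith
  induction n generalizing y with
  | zero =>
    refine ⟨y, hyN, by simp at hyx; linarith, by simpa using hgy, ?_⟩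
    rw [sub_self, abs_zero]
    positivity
  | succ n ih =>
    obtain ⟨z, hz, hzN, hgz⟩ := hstep n y hyx
    rw [mem_ball] at hz
    have hzx : dist z x < r + r * q ^ n := by
      have := dist_triangle z y x
      rw [pow_succ] at hyx
      nlinarith
    obtain ⟨w, hwN, hwx, hgw, huw⟩ := ih z hzN hzx hgz
    refine ⟨w, hwN, hwx, hgw, ?_⟩
    have hd : dist y z ^ s ≤ (q ^ s) ^ n * r ^ s := by
      have hle : dist y z ≤ q ^ n * r := by
        rw [dist_comm]
        have : 0 < q * (q ^ n * r) := by positivity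
        nlinarith
      calc dist y z ^ s ≤ (q ^ n * r) ^ s := Real.rpow_le_rpow dist_nonneg hle hs
        _ = (q ^ s) ^ n * r ^ s := by
          rw [Real.mul_rpow (by positivity) hr.le, ← Real.rpow_natCast, ← Real.rpow_mul hq.le,
            mul_comm, mul_comm (n : ℝ) s, Real.rpow_mul hq.le, Real.rpow_natCast, mul_comm]
    have huz : |u y - u z| ≤ 3 * τ * r ^ s * (2 * q ^ s) ^ n := by
      calc |u y - u z| ≤ dist y z ^ s * (g y + g z) := hgrad y hyN z hzN
        _ ≤ dist y z ^ s * (2 ^ (n + 1) * τ + 2 ^ n * τ) := by gcongr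
        _ ≤ ((q ^ s) ^ n * r ^ s) * (2 ^ (n + 1) * τ + 2 ^ n * τ) := by gcongr
        _ = 3 * τ * r ^ s * (2 * q ^ s) ^ n := by rw [mul_pow, pow_succ]; ring
    calc |u y - u w| ≤ |u y - u z| + |u z - u w| := abs_sub_le _ _ _
      _ ≤ 3 * τ * r ^ s * (2 * q ^ s) ^ n +
          3 * τ * r ^ s / (2 * q ^ s - 1) * (2 * q ^ s) ^ n := add_le_add huz huw
      _ = 3 * τ * r ^ s / (2 * q ^ s - 1) * (2 * q ^ s) ^ (n + 1) := by
        rw [pow_succ]; field_simp; ring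

/-- Every `t ≥ 0` lies below some `2 ^ n` for which `(2 ^ γ) ^ n` is controlled by `t ^ γ`. -/
theorem exists_two_pow_rpow_le {t γ : ℝ} (ht : 0 ≤ t) (hγ : 0 ≤ γ) (hγ1 : γ ≤ 1) :
    ∃ n : ℕ, t ≤ 2 ^ n ∧ ((2 : ℝ) ^ γ) ^ n ≤ 2 * (1 + t ^ γ) := by
  have ht' : 0 ≤ t ^ γ := Real.rpow_nonneg ht γ
  rcases le_or_gt t 1 with h | h
  · exact ⟨0, by simpa using h, by rw [pow_zero]; linarith⟩
  · obtain ⟨n, hn, hn'⟩ := exists_nat_pow_near h.le (one_lt_two : (1 : ℝ) < 2)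
    refine ⟨n + 1, hn'.le, ?_⟩
    have h2 : ((2 : ℝ) ^ γ) ^ n ≤ t ^ γ := by
      rw [← Real.rpow_natCast, ← Real.rpow_mul zero_le_two, mul_comm,
        Real.rpow_mul zero_le_two, Real.rpow_natCast]
      exact Real.rpow_le_rpow (by positivity) hn hγ
    have h1 : (2 : ℝ) ^ γ ≤ 2 := by
      simpa using Real.rpow_le_rpow_of_exponent_le one_le_two hγ1
    calc ((2 : ℝ) ^ γ) ^ (n + 1) = ((2 : ℝ) ^ γ) ^ n * (2 : ℝ) ^ γ := pow_succ _ _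
      _ ≤ t ^ γ * 2 := by gcongr
      _ ≤ 2 * (1 + t ^ γ) := by linarith

/-- Pointwise oscillation estimate for a function with a Hajłasz gradient. -/
theorem DimLowerBound.exists_pointwise_bound [PseudoMetricSpace X] [MeasurableSpace X]
    {μ : Measure X} {c Q : ℝ} (hdim : DimLowerBound μ c Q) (hc : 0 < c) (hQ : 0 < Q)
    {s p : ℝ} (hs : 0 ≤ s) (hp : 0 < p) (hsp : s * p < Q) :
    ∃ L : ℝ, 0 < L ∧ ∀ (u g : X → ℝ), Measurable g → (∀ y, 0 ≤ g y) →
      ∀ (N : Set X), μ N = 0 →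
      (∀ y ∉ N, ∀ z ∉ N, |u y - u z| ≤ dist y z ^ s * (g y + g z)) →
      ∀ (x : X) (r α : ℝ), 0 < r → 0 < α → μ (ball x (2 * r)) ≠ 0 → μ (ball x (2 * r)) ≠ ∞ →
      ∫⁻ z in ball x (2 * r), ENNReal.ofReal (g z ^ p) ∂μ ≤
        ENNReal.ofReal (α ^ p) * μ (ball x (2 * r)) →
      ∃ k : ℝ, ∀ y ∉ N, y ∈ ball x r →
        |u y - k| ≤ L * r ^ s * α * (1 + (g y / α) ^ (1 - s * p / Q)) := by
  set q : ℝ := 2 ^ (-(p / Q)) with hq_def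
  set γ : ℝ := 1 - s * p / Q with hγ_def
  have hq : 0 < q := by positivity
  have hq1 : q < 1 := Real.rpow_lt_one_of_one_lt_of_neg one_lt_two (by
    have : 0 < p / Q := by positivity
    linarith)
  have hγ : 0 < γ := by rw [hγ_def, sub_pos, div_lt_one hQ]; exact hsp
  have hγ1 : γ ≤ 1 := by
    have : 0 ≤ s * p / Q := by positivity
    linarith
  have hbγ : 2 * q ^ s = 2 ^ γ := by
    rw [hq_def, ← Real.rpow_mul zero_le_two, hγ_def, sub_eq_add_neg,
      Real.rpow_add zero_lt_two, Real.rpow_one]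
    congr 2
    ring
  have hb : 1 < 2 * q ^ s := by rw [hbγ]; exact Real.one_lt_rpow one_lt_two hγ
  have hb' : 0 < 2 * q ^ s - 1 := by linarith
  have hqQ : q ^ Q = 2 ^ (-p) := by
    rw [hq_def, ← Real.rpow_mul zero_le_two]
    congr 1
    field_simp
  set κ : ℝ := c * ((1 - q) / 2) ^ Q with hκ_def
  have h1q : 0 < 1 - q := by linarith
  have hκ : 0 < κ := by positivity
  set T : ℝ := (1 + 1 / κ) ^ (1 / p) with hT_def
  have hTp : T ^ p = 1 + 1 / κ := by
    rw [hT_def, ← Real.rpow_mul (by positivity), one_div_mul_cancel hp.ne', Real.rpow_one]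
  have hT1 : 1 ≤ T := Real.one_le_rpow (by
    have : 0 < 1 / κ := by positivity
    linarith) (by positivity)
  have hT : 0 < T := by linarith
  refine ⟨2 * (3 * T / (2 * q ^ s - 1)) + 2 * T * 4 ^ s, by positivity, ?_⟩
  intro u g hg hg0 N hN hgrad x r α hr hα h0 htop hint
  have hstep : ∀ (n : ℕ) (y : X), dist y x < r + r * q ^ (n + 1) →
      ∃ z ∈ ball y ((1 - q) * q ^ n * r), z ∉ N ∧ g z ≤ 2 ^ n * (T * α) := by
    intro n y hy
    refine hdim.exists_mem_ball_le hg hp (by positivity) (by positivity) ?_ h0 htop hint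
      (by positivity) ?_ hN
    · have : r * q ^ n ≤ r := mul_le_of_le_one_right hr.le (pow_le_one₀ hq.le hq1.le)
      rw [pow_succ] at hy
      nlinarith
    · have e1 : ((1 - q) * q ^ n * r / (2 * r)) ^ Q = ((1 - q) / 2) ^ Q * (2 ^ (-p)) ^ n := by
        have : (1 - q) * q ^ n * r / (2 * r) = (1 - q) / 2 * q ^ n := by field_simp
        rw [this, Real.mul_rpow (by positivity) (by positivity), ← hqQ, ← Real.rpow_natCast,
          ← Real.rpow_natCast, ← Real.rpow_mul hq.le, ← Real.rpow_mul hq.le, mul_comm (n : ℝ)]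
      have e2 : ((2 : ℝ) ^ n * (T * α)) ^ p = (2 ^ p) ^ n * (T ^ p * α ^ p) := by
        rw [Real.mul_rpow (by positivity) (by positivity), Real.mul_rpow hT.le hα.le,
          ← Real.rpow_natCast, ← Real.rpow_natCast, ← Real.rpow_mul zero_le_two,
          ← Real.rpow_mul zero_le_two, mul_comm (n : ℝ)]
      have e3 : ((2 : ℝ) ^ p) ^ n * (2 ^ (-p)) ^ n = 1 := by
        rw [← mul_pow, ← Real.rpow_add zero_lt_two, add_neg_cancel, Real.rpow_zero, one_pow]
      have e4 : ((2 : ℝ) ^ n * (T * α)) ^ p * (c * ((1 - q) * q ^ n * r / (2 * r)) ^ Q) =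
          (κ + 1) * α ^ p := by
        rw [e1, e2, hTp]
        calc _ = (((2 : ℝ) ^ p) ^ n * (2 ^ (-p)) ^ n) * ((1 + 1 / κ) * κ) * α ^ p := by
              rw [hκ_def]; ring
          _ = _ := by rw [e3]; field_simp
      rw [e4]
      have : 0 < κ * α ^ p := by positivity
      linarith
  obtain ⟨z₀, hz₀, hz₀N, hgz₀⟩ := hstep 0 x (by rw [dist_self]; positivity)
  refine ⟨u z₀, fun y hyN hy => ?_⟩
  rw [mem_ball] at hy hz₀
  obtain ⟨n, hn, hn'⟩ := exists_two_pow_rpow_le (div_nonneg (hg0 y) hα.le) hγ.le hγ1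
  have hgy : g y ≤ 2 ^ n * (T * α) := by
    rw [div_le_iff₀ hα] at hn
    refine hn.trans ?_
    gcongr
    exact le_mul_of_one_le_left hα.le hT1
  obtain ⟨z, hzN, hzx, hgz, huz⟩ := exists_chain_end hs hgrad hr hq (mul_pos hT hα) hb hstep
    n y hyN (hy.trans_le (le_add_of_nonneg_right (by positivity))) hgy
  have hzz : |u z - u z₀| ≤ (4 * r) ^ s * (T * α + T * α) := by
    have hzd : dist z z₀ ≤ 4 * r := by
      have h1 := dist_triangle_right z z₀ x
      have h2 : (1 - q) * q ^ 0 * r ≤ r := by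
        rw [pow_zero, mul_one]
        exact mul_le_of_le_one_left hr.le (by linarith)
      linarith
    refine (hgrad z hzN z₀ hz₀N).trans ?_
    rw [pow_zero, one_mul] at hgz₀
    have := hg0 z
    have := hg0 z₀
    gcongr
  rw [Real.mul_rpow (by norm_num) hr.le] at hzz
  have hW : 0 ≤ (g y / α) ^ γ := Real.rpow_nonneg (div_nonneg (hg0 y) hα.le) _
  calc |u y - u z₀| ≤ |u y - u z| + |u z - u z₀| := abs_sub_le _ _ _
    _ ≤ 3 * (T * α) * r ^ s / (2 * q ^ s - 1) * (2 * (1 + (g y / α) ^ γ)) +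
        4 ^ s * r ^ s * (T * α + T * α) := by
      refine add_le_add (huz.trans ?_) hzz
      rw [hbγ] at hb' ⊢
      gcongr
    _ ≤ 3 * (T * α) * r ^ s / (2 * q ^ s - 1) * (2 * (1 + (g y / α) ^ γ)) +
        4 ^ s * r ^ s * (T * α + T * α) * (1 + (g y / α) ^ γ) := by
      refine add_le_add le_rfl (le_mul_of_one_le_right (by positivity) (by linarith))
    _ = _ := by ring

/-- The Sobolev–Poincaré inequality with an upper bound `α ^ p` of the average of `g ^ p`. -/
theorem DimLowerBound.exists_laverage_rpow_le [PseudoMetricSpace X] [MeasurableSpace X]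
    {μ : Measure X} {c Q : ℝ} (hdim : DimLowerBound μ c Q) (hc : 0 < c) (hQ : 0 < Q)
    {s p : ℝ} (hs : 0 ≤ s) (hp : 0 < p) (hsp : s * p < Q) :
    ∃ C : ℝ, 0 < C ∧ ∀ (u g : X → ℝ), IsHajlaszGradient μ s u g →
      ∀ (x : X) (r α : ℝ), 0 < r → 0 < α →
      ⨍⁻ z in ball x (2 * r), ENNReal.ofReal (g z ^ p) ∂μ ≤ ENNReal.ofReal (α ^ p) →
      ∃ k : ℝ, (⨍⁻ y in ball x r,
        ENNReal.ofReal (|u y - k| ^ (Q * p / (Q - s * p))) ∂μ) ^ ((Q - s * p) / (Q * p)) ≤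
          ENNReal.ofReal (C * r ^ s * α) := by
  obtain ⟨L, hL, hpt⟩ := hdim.exists_pointwise_bound hc hQ hs hp hsp
  have hQsp : 0 < Q - s * p := by linarith
  set P : ℝ := Q * p / (Q - s * p) with hP_def
  have hP : 0 < P := by positivity
  have hPinv : (Q - s * p) / (Q * p) = P⁻¹ := by rw [hP_def, inv_div]
  have hγP : (1 - s * p / Q) * P = p := by rw [hP_def]; field_simp
  set D : ℝ := (c * (1 / 2) ^ Q)⁻¹ with hD_def
  have hD : 0 < D := by positivity
  refine ⟨2 * L * (1 + D) ^ P⁻¹, by positivity, ?_⟩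
  rintro u g ⟨hg, hg0, N, hN, hgrad⟩ x r α hr hα havg
  rw [hPinv]
  have hdoub : μ (ball x (2 * r)) ≤ ENNReal.ofReal D * μ (ball x r) := by
    have h := hdim x x r (2 * r) hr (by linarith) (mem_ball_self (by linarith))
    have e : r / (2 * r) = 1 / 2 := by field_simp
    rw [e] at h
    calc μ (ball x (2 * r))
        = ENNReal.ofReal D * (ENNReal.ofReal (c * (1 / 2) ^ Q) * μ (ball x (2 * r))) := by
          rw [← mul_assoc, ← ENNReal.ofReal_mul hD.le, hD_def, inv_mul_cancel₀ (by positivity),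
            ENNReal.ofReal_one, one_mul]
      _ ≤ _ := by gcongr
  have hmono : μ (ball x r) ≤ μ (ball x (2 * r)) :=
    measure_mono (ball_subset_ball (by linarith))
  by_cases h0 : μ (ball x r) = 0
  · refine ⟨0, ?_⟩
    rw [setLAverage_eq, Measure.restrict_eq_zero.2 h0]
    simp [hP]
  by_cases htop : μ (ball x r) = ∞
  · refine ⟨0, ?_⟩
    rw [setLAverage_eq, htop, ENNReal.div_top, ENNReal.zero_rpow_of_pos (by positivity)]
    exact zero_le
  have h0' : μ (ball x (2 * r)) ≠ 0 := fun h => h0 (le_antisymm (hmono.trans h.le) zero_le)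
  have htop' : μ (ball x (2 * r)) ≠ ∞ :=
    ne_top_of_le_ne_top (ENNReal.mul_ne_top ENNReal.ofReal_ne_top htop) hdoub
  have hint : ∫⁻ z in ball x (2 * r), ENNReal.ofReal (g z ^ p) ∂μ ≤
      ENNReal.ofReal (α ^ p) * μ (ball x (2 * r)) := by
    rwa [setLAverage_eq, ENNReal.div_le_iff h0' htop'] at havg
  obtain ⟨k, hk⟩ := hpt u g hg hg0 N hN hgrad x r α hr hα h0' htop' hint
  refine ⟨k, ?_⟩
  set A : ℝ := (2 * L * r ^ s * α) ^ P with hA_def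
  have hA : 0 < A := by positivity
  have hbound : ∀ y ∉ N, y ∈ ball x r → |u y - k| ^ P ≤ A * (1 + (α ^ p)⁻¹ * g y ^ p) := by
    intro y hyN hy
    have ht : 0 ≤ g y / α := div_nonneg (hg0 y) hα.le
    set w : ℝ := (g y / α) ^ (1 - s * p / Q) with hw_def
    have hw : 0 ≤ w := Real.rpow_nonneg ht _
    have hwP : w ^ P = (α ^ p)⁻¹ * g y ^ p := by
      rw [hw_def, ← Real.rpow_mul ht, hγP, Real.div_rpow (hg0 y) hα.le, div_eq_inv_mul]
    rw [← hwP]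
    have hmax : (max 1 w) ^ P ≤ 1 + w ^ P := by
      have := Real.rpow_nonneg hw P
      rcases le_total 1 w with h | h
      · rw [max_eq_right h]; linarith
      · rw [max_eq_left h, Real.one_rpow]; linarith
    calc |u y - k| ^ P ≤ (2 * L * r ^ s * α * max 1 w) ^ P := by
          refine Real.rpow_le_rpow (abs_nonneg _) ((hk y hyN hy).trans ?_) hP.le
          calc L * r ^ s * α * (1 + w) ≤ L * r ^ s * α * (max 1 w + max 1 w) := by
                gcongr
                · exact le_max_left _ _
                · exact le_max_right _ _
            _ = _ := by ring
      _ = A * (max 1 w) ^ P := by rw [Real.mul_rpow (by positivity) (by positivity)]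
      _ ≤ A * (1 + w ^ P) := by gcongr
  have hgm : Measurable fun y => ENNReal.ofReal (g y ^ p) := (hg.pow_const p).ennreal_ofReal
  have hintegral : ∫⁻ y in ball x r, ENNReal.ofReal (|u y - k| ^ P) ∂μ ≤
      ENNReal.ofReal (A * (1 + D)) * μ (ball x r) := by
    calc ∫⁻ y in ball x r, ENNReal.ofReal (|u y - k| ^ P) ∂μ
        ≤ ∫⁻ y in ball x r, ENNReal.ofReal A *
            (1 + ENNReal.ofReal (α ^ p)⁻¹ * ENNReal.ofReal (g y ^ p)) ∂μ := by
          refine setLIntegral_mono_ae (by fun_prop) ?_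
          filter_upwards [compl_mem_ae_iff.2 hN] with y hyN hy
          refine (ENNReal.ofReal_le_ofReal (hbound y hyN hy)).trans_eq ?_
          have := Real.rpow_nonneg (hg0 y) p
          rw [ENNReal.ofReal_mul hA.le, ENNReal.ofReal_add zero_le_one (by positivity),
            ENNReal.ofReal_mul (by positivity), ENNReal.ofReal_one]
      _ = ENNReal.ofReal A * (μ (ball x r) + ENNReal.ofReal (α ^ p)⁻¹ *
            ∫⁻ y in ball x r, ENNReal.ofReal (g y ^ p) ∂μ) := by
          rw [lintegral_const_mul _ (by fun_prop), lintegral_add_left measurable_const,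
            lintegral_const_mul _ hgm, lintegral_const, Measure.restrict_apply_univ, one_mul]
      _ ≤ ENNReal.ofReal A * (μ (ball x r) + ENNReal.ofReal (α ^ p)⁻¹ *
            (ENNReal.ofReal (α ^ p) * (ENNReal.ofReal D * μ (ball x r)))) := by
          gcongr
          refine (lintegral_mono' (Measure.restrict_mono (ball_subset_ball (by linarith)) le_rfl)
            le_rfl).trans (hint.trans ?_)
          gcongr
      _ = ENNReal.ofReal (A * (1 + D)) * μ (ball x r) := by
          rw [← mul_assoc (ENNReal.ofReal (α ^ p)⁻¹), ← ENNReal.ofReal_mul (by positivity),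
            inv_mul_cancel₀ (by positivity), ENNReal.ofReal_one, one_mul,
            ENNReal.ofReal_mul hA.le, ENNReal.ofReal_add zero_le_one hD.le, ENNReal.ofReal_one]
          ring
  have hlav : ⨍⁻ y in ball x r, ENNReal.ofReal (|u y - k| ^ P) ∂μ ≤
      ENNReal.ofReal (A * (1 + D)) := by
    rwa [setLAverage_eq, ENNReal.div_le_iff h0 htop]
  calc _ ≤ ENNReal.ofReal (A * (1 + D)) ^ P⁻¹ := ENNReal.rpow_le_rpow hlav (by positivity)
    _ = ENNReal.ofReal (2 * L * (1 + D) ^ P⁻¹ * r ^ s * α) := by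
      rw [ENNReal.ofReal_rpow_of_pos (by positivity), Real.mul_rpow hA.le (by positivity), hA_def,
        Real.rpow_rpow_inv (by positivity) hP.ne']
      congr 1
      ring

theorem statement5 [MetricSpace X] [MeasurableSpace X] (μ : Measure X)
    (c_d : ℝ≥0∞) (hdoub : IsDoubling μ c_d) (Q : ℝ) (hQ : 1 < Q)
    (c_Q : ℝ) (hcQ : 0 < c_Q) (hdim : DimLowerBound μ c_Q Q)
    (s p : ℝ) (hs : 0 ≤ s) (hp : 0 < p) (hsp : s * p < Q) :
    ∃ C : ℝ, 0 < C ∧ ∀ (u g : X → ℝ), Measurable u → IsHajlaszGradient μ s u g →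
      ∀ (x : X) (r : ℝ), 0 < r →
        ⨅ c : ℝ, (⨍⁻ y in ball x r,
              ENNReal.ofReal (|u y - c| ^ (Q * p / (Q - s * p))) ∂μ) ^ ((Q - s * p) / (Q * p)) ≤
          ENNReal.ofReal (C * r ^ s) *
            (⨍⁻ y in ball x (2 * r), ENNReal.ofReal (g y ^ p) ∂μ) ^ (1 / p) := by
  obtain ⟨C, hC, hbound⟩ :=
    hdim.exists_laverage_rpow_le hcQ (zero_lt_one.trans hQ) hs hp hsp
  refine ⟨C, hC, fun u g _ hgrad x r hr => ?_⟩
  set A := ⨍⁻ y in ball x (2 * r), ENNReal.ofReal (g y ^ p) ∂μ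
  have hCr : 0 < C * r ^ s := by positivity
  rcases eq_or_ne A ∞ with hA | hA
  · rw [hA, ENNReal.top_rpow_of_pos (by positivity),
      ENNReal.mul_top (by simpa using hCr)]
    exact le_top
  have hA' : A ^ (1 / p) ≠ ∞ := ENNReal.rpow_ne_top_of_nonneg (by positivity) hA
  rw [mul_comm (ENNReal.ofReal _), ← ENNReal.div_le_iff (by simpa using hCr) ENNReal.ofReal_ne_top]
  refine ENNReal.le_of_forall_pos_le_add fun ε hε _ => ?_
  rw [ENNReal.div_le_iff (by simpa using hCr) ENNReal.ofReal_ne_top]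
  set α : ℝ := (A ^ (1 / p)).toReal + ε
  have hα : 0 < α := add_pos_of_nonneg_of_pos ENNReal.toReal_nonneg hε
  have hαeq : ENNReal.ofReal α = A ^ (1 / p) + ε := by
    rw [ENNReal.ofReal_add ENNReal.toReal_nonneg ε.coe_nonneg, ENNReal.ofReal_toReal hA',
      ENNReal.ofReal_coe_nnreal]
  have hAα : A ≤ ENNReal.ofReal (α ^ p) := by
    rw [← ENNReal.ofReal_rpow_of_pos hα, hαeq]
    calc A = (A ^ (1 / p)) ^ p := by
          rw [← ENNReal.rpow_mul, one_div_mul_cancel hp.ne', ENNReal.rpow_one]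
      _ ≤ _ := ENNReal.rpow_le_rpow le_self_add hp.le
  obtain ⟨k, hk⟩ := hbound u g hgrad x r α hr hα hAα
  refine (iInf_le _ k).trans (hk.trans_eq ?_)
  rw [← hαeq, ← ENNReal.ofReal_mul hα.le, mul_comm α]

end FracMaximal
end

section
/- Let 0 < s + α ≤ 1 and Q/(Q+s) < p < ∞. There exists C > 0 such that ‖M*_α u‖_{Ṁ^{s+α,p}(X)} ≤ C ‖u‖_{Ṁ^{s,p}(X)} for all u ∈ Ṁ^{s,p}(X) with M*_α u not identically infinite. -/
open MeasureTheory Metric ENNReal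

namespace FracMaximal

variable {X : Type*}

/-- The uncentered Hardy--Littlewood maximal function. -/
noncomputable def uncenteredMax [PseudoMetricSpace X] [MeasurableSpace X] (μ : Measure X)
    (f : X → ℝ≥0∞) (x : X) : ℝ≥0∞ :=
  ⨆ (z : X) (r : ℝ) (_ : x ∈ ball z r), (∫⁻ y in ball z r, f y ∂μ) / μ (ball z r)

/-- All balls have positive and finite measure. -/
def BallsPosFinite [PseudoMetricSpace X] [MeasurableSpace X] (μ : Measure X) : Prop :=
  ∀ (x : X) (r : ℝ), 0 < r → μ (ball x r) ≠ 0 ∧ μ (ball x r) ≠ ⊤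

section Maximal

variable [PseudoMetricSpace X] [MeasurableSpace X] {μ : Measure X}

theorem lintegral_ball_le_uncenteredMax_mul (hb : BallsPosFinite μ) (f : X → ℝ≥0∞) {x z : X}
    {r : ℝ} (hx : x ∈ ball z r) :
    ∫⁻ y in ball z r, f y ∂μ ≤ uncenteredMax μ f x * μ (ball z r) := by
  have hr : 0 < r := pos_of_mem_ball hx
  rw [← ENNReal.div_le_iff (hb z r hr).1 (hb z r hr).2]
  exact le_iSup_of_le z (le_iSup_of_le r (le_iSup_of_le hx le_rfl))

theorem setOf_lt_uncenteredMax_eq (f : X → ℝ≥0∞) (l : ℝ≥0∞) :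
    {x | l < uncenteredMax μ f x} =
      ⋃ a ∈ {a : X × ℝ | l < (∫⁻ y in ball a.1 a.2, f y ∂μ) / μ (ball a.1 a.2)},
        ball a.1 a.2 := by
  ext x
  simp only [uncenteredMax, lt_iSup_iff, Set.mem_ofPred_eq, Set.mem_iUnion, Prod.exists, exists_prop]
  constructor
  · rintro ⟨z, r, h, h'⟩
    exact ⟨z, r, h', h⟩
  · rintro ⟨z, r, h', h⟩
    exact ⟨z, r, h, h'⟩

theorem measurable_uncenteredMax [OpensMeasurableSpace X] (f : X → ℝ≥0∞) :
    Measurable (uncenteredMax μ f) := by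
  refine measurable_of_Ioi fun l => IsOpen.measurableSet ?_
  change IsOpen {x | l < uncenteredMax μ f x}
  rw [setOf_lt_uncenteredMax_eq]
  exact isOpen_biUnion fun a _ => isOpen_ball

theorem mul_measure_biUnion_ball_le [SecondCountableTopology X] [OpensMeasurableSpace X]
    {K : ℝ≥0∞} (hK : ∀ (x : X) (r : ℝ), 0 < r → μ (ball x (5 * r)) ≤ K * μ (ball x r))
    (f : X → ℝ≥0∞) {l : ℝ≥0∞} {R : ℝ} (t : Set (X × ℝ))
    (ht : ∀ a ∈ t, 0 < a.2 ∧ a.2 ≤ R ∧ l * μ (ball a.1 a.2) ≤ ∫⁻ y in ball a.1 a.2, f y ∂μ) :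
    l * μ (⋃ a ∈ t, ball a.1 a.2) ≤ K * ∫⁻ y, f y ∂μ := by
  obtain ⟨u, hut, hdisj, hcov⟩ := Vitali.exists_disjoint_subfamily_covering_enlargement_closedBall
    t (fun a => a.1) (fun a => a.2) R (fun a ha => (ht a ha).2.1) 4 (by norm_num)
  have hdisj' : u.PairwiseDisjoint fun a => ball a.1 a.2 := fun a ha b hb hab =>
    (hdisj ha hb hab).mono ball_subset_closedBall ball_subset_closedBall
  have hcount : u.Countable := hdisj'.countable_of_isOpen (fun a _ => isOpen_ball)
    fun a ha => nonempty_ball.2 (ht a (hut ha)).1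
  have hsub : (⋃ a ∈ t, ball a.1 a.2) ⊆ ⋃ b ∈ u, ball b.1 (5 * b.2) := by
    refine Set.iUnion₂_subset fun a ha => ?_
    obtain ⟨b, hb, hab⟩ := hcov a ha
    have hbpos := (ht b (hut hb)).1
    refine (ball_subset_closedBall.trans (hab.trans (closedBall_subset_ball ?_))).trans
      (Set.subset_biUnion_of_mem (u := fun b : X × ℝ => ball b.1 (5 * b.2)) hb)
    linarith
  have := hcount.to_subtype
  calc l * μ (⋃ a ∈ t, ball a.1 a.2)
      ≤ l * ∑' b : u, μ (ball b.1.1 (5 * b.1.2)) := by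
        gcongr
        exact (measure_mono hsub).trans (measure_biUnion_le μ hcount _)
    _ ≤ l * ∑' b : u, K * μ (ball b.1.1 b.1.2) := by
        gcongr with b
        exact hK _ _ (ht b.1 (hut b.2)).1
    _ = K * ∑' b : u, l * μ (ball b.1.1 b.1.2) := by
        rw [ENNReal.tsum_mul_left, ENNReal.tsum_mul_left]
        ring
    _ ≤ K * ∑' b : u, ∫⁻ y in ball b.1.1 b.1.2, f y ∂μ := by
        gcongr with b
        exact (ht b.1 (hut b.2)).2.2
    _ = K * ∫⁻ y in ⋃ b ∈ u, ball b.1 b.2, f y ∂μ := by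
        rw [lintegral_biUnion hcount (fun b _ => measurableSet_ball) hdisj']
    _ ≤ K * ∫⁻ y, f y ∂μ := by
        gcongr
        exact Measure.restrict_le_self

/-- Weak type (1,1) estimate for the uncentered maximal function. -/
theorem mul_measure_lt_uncenteredMax_le [SecondCountableTopology X] [OpensMeasurableSpace X]
    (hb : BallsPosFinite μ)
    {K : ℝ≥0∞} (hK : ∀ (x : X) (r : ℝ), 0 < r → μ (ball x (5 * r)) ≤ K * μ (ball x r))
    (f : X → ℝ≥0∞) (l : ℝ≥0∞) :
    l * μ {x | l < uncenteredMax μ f x} ≤ K * ∫⁻ y, f y ∂μ := by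
  set t : ℕ → Set (X × ℝ) := fun n => {a | a.2 ≤ n ∧ 0 < a.2 ∧
    l < (∫⁻ y in ball a.1 a.2, f y ∂μ) / μ (ball a.1 a.2)} with ht
  have hunion : {x | l < uncenteredMax μ f x} = ⋃ n, ⋃ a ∈ t n, ball a.1 a.2 := by
    rw [setOf_lt_uncenteredMax_eq]
    ext x
    simp only [ht, Set.mem_iUnion, Set.mem_ofPred_eq, exists_prop]
    constructor
    · rintro ⟨a, ha, hx⟩
      obtain ⟨n, hn⟩ := exists_nat_ge a.2
      exact ⟨n, a, ⟨hn, pos_of_mem_ball hx, ha⟩, hx⟩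
    · rintro ⟨n, a, ha, hx⟩
      exact ⟨a, ha.2.2, hx⟩
  have hmono : Monotone fun n => ⋃ a ∈ t n, ball a.1 a.2 := by
    intro m n hmn
    refine Set.biUnion_subset_biUnion_left fun a ha => ⟨ha.1.trans ?_, ha.2⟩
    exact_mod_cast hmn
  rw [hunion, hmono.measure_iUnion, ENNReal.mul_iSup]
  refine iSup_le fun n => mul_measure_biUnion_ball_le hK f (R := n) (t n) fun a ha => ?_
  refine ⟨ha.2.1, ha.1, ?_⟩
  have h := hb a.1 a.2 ha.2.1
  exact (ENNReal.le_div_iff_mul_le (Or.inl h.1) (Or.inl h.2)).1 ha.2.2.le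

end Maximal

section StrongType

variable [PseudoMetricSpace X] [MeasurableSpace X] {μ : Measure X}

theorem uncenteredMax_le_add (hb : BallsPosFinite μ) {f g : X → ℝ≥0∞} {c : ℝ≥0∞}
    (h : ∀ x, f x ≤ g x + c) (x : X) : uncenteredMax μ f x ≤ uncenteredMax μ g x + c := by
  refine iSup_le fun z => iSup_le fun r => iSup_le fun hx => ?_
  have hr : 0 < r := pos_of_mem_ball hx
  have hbz := hb z r hr
  rw [ENNReal.div_le_iff hbz.1 hbz.2]
  calc ∫⁻ y in ball z r, f y ∂μ ≤ ∫⁻ y in ball z r, (g y + c) ∂μ := lintegral_mono h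
    _ = ∫⁻ y in ball z r, g y ∂μ + c * μ (ball z r) := by
        rw [lintegral_add_right _ measurable_const, setLIntegral_const]
    _ ≤ uncenteredMax μ g x * μ (ball z r) + c * μ (ball z r) := by
        gcongr
        exact lintegral_ball_le_uncenteredMax_mul hb g hx
    _ = _ := by ring

theorem mul_measure_lt_uncenteredMax_le_setLIntegral [SecondCountableTopology X]
    [OpensMeasurableSpace X] (hb : BallsPosFinite μ)
    {K : ℝ≥0∞} (hK : ∀ (x : X) (r : ℝ), 0 < r → μ (ball x (5 * r)) ≤ K * μ (ball x r))
    {f : X → ℝ} (hf : Measurable f) {l : ℝ} (hl : 0 < l) :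
    ENNReal.ofReal l * μ {x | ENNReal.ofReal l < uncenteredMax μ (fun y => ENNReal.ofReal (f y)) x}
      ≤ 2 * K * ∫⁻ y in {y | l < 2 * f y}, ENNReal.ofReal (f y) ∂μ := by
  have hmeas : MeasurableSet {y | l < 2 * f y} := measurableSet_lt measurable_const (hf.const_mul 2)
  set g : X → ℝ≥0∞ := {y | l < 2 * f y}.indicator fun y => ENNReal.ofReal (f y) with hg
  have hfg : ∀ y, ENNReal.ofReal (f y) ≤ g y + ENNReal.ofReal (l / 2) := by
    intro y
    by_cases hy : l < 2 * f y
    · rw [hg, Set.indicator_of_mem (by exact hy)]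
      exact le_self_add
    · refine le_add_left (ENNReal.ofReal_le_ofReal ?_)
      linarith
  have hsplit : ENNReal.ofReal l = ENNReal.ofReal (l / 2) + ENNReal.ofReal (l / 2) := by
    rw [← ENNReal.ofReal_add (by positivity) (by positivity), add_halves]
  have hsub : {x | ENNReal.ofReal l < uncenteredMax μ (fun y => ENNReal.ofReal (f y)) x} ⊆
      {x | ENNReal.ofReal (l / 2) < uncenteredMax μ g x} := by
    intro x hx
    have h1 := lt_of_lt_of_le hx (uncenteredMax_le_add hb hfg x)
    rw [hsplit] at h1
    exact lt_of_add_lt_add_right h1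
  calc _ ≤ 2 * (ENNReal.ofReal (l / 2) * μ {x | ENNReal.ofReal (l / 2) < uncenteredMax μ g x}) := by
        rw [← mul_assoc, two_mul, ← hsplit]
        gcongr
    _ ≤ 2 * (K * ∫⁻ y, g y ∂μ) := by
        gcongr 2 * ?_
        exact mul_measure_lt_uncenteredMax_le hb hK g _
    _ = _ := by rw [hg, lintegral_indicator hmeas, mul_assoc]

theorem ae_uncenteredMax_lt_top [SecondCountableTopology X] [OpensMeasurableSpace X]
    (hb : BallsPosFinite μ) {K : ℝ≥0∞} (hKtop : K ≠ ⊤)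
    (hK : ∀ (x : X) (r : ℝ), 0 < r → μ (ball x (5 * r)) ≤ K * μ (ball x r))
    {t : ℝ} (ht : 1 < t) {f : X → ℝ} (hf : Measurable f)
    (hfin : ∫⁻ y, ENNReal.ofReal (f y ^ t) ∂μ ≠ ⊤) :
    ∀ᵐ x ∂μ, uncenteredMax μ (fun y => ENNReal.ofReal (f y)) x < ⊤ := by
  set M := uncenteredMax μ fun y => ENNReal.ofReal (f y) with hM
  set I := 2 * K * ∫⁻ y, ENNReal.ofReal (f y ^ t) ∂μ with hI
  have hItop : I ≠ ⊤ := by finiteness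
  have key : ∀ l : ℝ, 2 ≤ l → ENNReal.ofReal l * μ {x | ¬ M x < ⊤} ≤ I := by
    intro l hl
    have hmeas : MeasurableSet {y | l < 2 * f y} :=
      measurableSet_lt measurable_const (hf.const_mul 2)
    calc ENNReal.ofReal l * μ {x | ¬ M x < ⊤}
        ≤ ENNReal.ofReal l * μ {x | ENNReal.ofReal l < M x} := by
          gcongr with x
          intro hx
          rw [not_lt_top_iff] at hx
          rw [hx]
          exact ENNReal.ofReal_lt_top
      _ ≤ 2 * K * ∫⁻ y in {y | l < 2 * f y}, ENNReal.ofReal (f y) ∂μ :=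
          mul_measure_lt_uncenteredMax_le_setLIntegral hb hK hf (by linarith)
      _ ≤ 2 * K * ∫⁻ y in {y | l < 2 * f y}, ENNReal.ofReal (f y ^ t) ∂μ := by
          gcongr 2 * K * ?_
          refine setLIntegral_mono' hmeas fun y hy => ENNReal.ofReal_le_ofReal ?_
          have hy' : l < 2 * f y := hy
          exact Real.self_le_rpow_of_one_le (by linarith) ht.le
      _ ≤ I := by
          rw [hI]
          gcongr
          exact Measure.restrict_le_self
  rw [ae_iff]
  by_contra hne
  have hmtop : μ {x | ¬ M x < ⊤} ≠ ⊤ := by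
    intro h
    have := key 2 le_rfl
    rw [h, ENNReal.mul_top (by simp)] at this
    exact hItop (top_le_iff.1 this)
  set m := μ {x | ¬ M x < ⊤} with hm
  have hmpos : 0 < m.toReal := ENNReal.toReal_pos hne hmtop
  have h := key (2 + I.toReal / m.toReal) (by linarith [div_nonneg I.toReal_nonneg hmpos.le])
  rw [← ENNReal.ofReal_toReal hItop, ← ENNReal.ofReal_toReal hmtop,
    ← ENNReal.ofReal_mul (by positivity), ENNReal.ofReal_le_ofReal_iff (by positivity),
    ENNReal.toReal_ofReal (by positivity), ENNReal.toReal_ofReal (by positivity), add_mul,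
    div_mul_cancel₀ _ hmpos.ne'] at h
  linarith

/-- The Hardy--Littlewood maximal theorem. -/
theorem lintegral_uncenteredMax_rpow_le [SecondCountableTopology X] [OpensMeasurableSpace X]
    (hb : BallsPosFinite μ) {K : ℝ≥0∞} (hKtop : K ≠ ⊤)
    (hK : ∀ (x : X) (r : ℝ), 0 < r → μ (ball x (5 * r)) ≤ K * μ (ball x r))
    {t : ℝ} (ht : 1 < t) {f : X → ℝ} (hf : Measurable f) (hf0 : ∀ x, 0 ≤ f x)
    (hfin : ∫⁻ y, ENNReal.ofReal (f y ^ t) ∂μ ≠ ⊤) :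
    ∫⁻ x, uncenteredMax μ (fun y => ENNReal.ofReal (f y)) x ^ t ∂μ ≤
      ENNReal.ofReal t * (2 * K) * (ENNReal.ofReal (t - 1))⁻¹ * ENNReal.ofReal (2 ^ (t - 1)) *
        ∫⁻ y, ENNReal.ofReal (f y ^ t) ∂μ := by
  set M := uncenteredMax μ fun y => ENNReal.ofReal (f y) with hM
  have hMm : Measurable M := measurable_uncenteredMax _
  have hMfin : ∀ᵐ x ∂μ, M x < ⊤ := ae_uncenteredMax_lt_top hb hKtop hK ht hf hfin
  set ν := μ.withDensity fun y => ENNReal.ofReal (f y) with hν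
  have ht1 : 0 < t - 1 := by linarith
  have hlevel : ∀ l ∈ Set.Ioi (0 : ℝ), μ {a | l < (M a).toReal} * ENNReal.ofReal (l ^ (t - 1)) ≤
      2 * K * (ν {a | l < 2 * f a} * ENNReal.ofReal (l ^ (t - 1 - 1))) := by
    intro l hl
    have hl' : 0 < l := hl
    have hmeas : MeasurableSet {y | l < 2 * f y} :=
      measurableSet_lt measurable_const (hf.const_mul 2)
    have hpow : l ^ (t - 1) = l * l ^ (t - 1 - 1) := by
      rw [Real.rpow_sub_one hl'.ne' (t - 1)]
      field_simp
    have hsub : {a | l < (M a).toReal} ⊆ {a | ENNReal.ofReal l < M a} := by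
      intro a ha
      exact (ENNReal.ofReal_lt_iff_lt_toReal hl'.le (fun h => by
        have ha' : l < (M a).toReal := ha
        rw [h, ENNReal.toReal_top] at ha'
        linarith)).2 ha
    calc μ {a | l < (M a).toReal} * ENNReal.ofReal (l ^ (t - 1))
        ≤ (ENNReal.ofReal l * μ {a | ENNReal.ofReal l < M a}) *
            ENNReal.ofReal (l ^ (t - 1 - 1)) := by
          rw [hpow, ENNReal.ofReal_mul hl'.le, ← mul_assoc, mul_comm (μ _)]
          gcongr
      _ ≤ (2 * K * ∫⁻ y in {y | l < 2 * f y}, ENNReal.ofReal (f y) ∂μ) *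
            ENNReal.ofReal (l ^ (t - 1 - 1)) := by
          gcongr ?_ * ENNReal.ofReal _
          exact mul_measure_lt_uncenteredMax_le_setLIntegral hb hK hf hl'
      _ = _ := by rw [hν, withDensity_apply _ hmeas]; ring
  have hνint := lintegral_rpow_eq_lintegral_meas_lt_mul ν (f := fun a => 2 * f a)
    (Filter.Eventually.of_forall fun a => by have := hf0 a; positivity)
    (hf.const_mul 2).aemeasurable ht1
  have hνint' : ∫⁻ a, ENNReal.ofReal ((2 * f a) ^ (t - 1)) ∂ν =
      ENNReal.ofReal (2 ^ (t - 1)) * ∫⁻ y, ENNReal.ofReal (f y ^ t) ∂μ := by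
    rw [hν, lintegral_withDensity_eq_lintegral_mul _ hf.ennreal_ofReal (by fun_prop),
      ← lintegral_const_mul _ (by fun_prop)]
    refine lintegral_congr fun y => ?_
    have h0 := hf0 y
    rw [Pi.mul_apply, ← ENNReal.ofReal_mul h0, ← ENNReal.ofReal_mul (by positivity),
      Real.mul_rpow (by norm_num) h0]
    congr 1
    rcases h0.eq_or_lt with h | h
    · rw [← h, Real.zero_rpow (by linarith), Real.zero_rpow (by linarith)]
      ring
    · rw [Real.rpow_sub_one h.ne' t]
      field_simp
  calc ∫⁻ x, M x ^ t ∂μ = ∫⁻ x, ENNReal.ofReal ((M x).toReal ^ t) ∂μ := by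
        refine lintegral_congr_ae ?_
        filter_upwards [hMfin] with x hx
        rw [← ENNReal.ofReal_rpow_of_nonneg ENNReal.toReal_nonneg (by linarith),
          ENNReal.ofReal_toReal hx.ne]
    _ = ENNReal.ofReal t *
          ∫⁻ l in Set.Ioi 0, μ {a | l < (M a).toReal} * ENNReal.ofReal (l ^ (t - 1)) :=
        lintegral_rpow_eq_lintegral_meas_lt_mul μ
          (Filter.Eventually.of_forall fun a => ENNReal.toReal_nonneg)
          hMm.ennreal_toReal.aemeasurable (by linarith)
    _ ≤ ENNReal.ofReal t * ∫⁻ l in Set.Ioi 0,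
          2 * K * (ν {a | l < 2 * f a} * ENNReal.ofReal (l ^ (t - 1 - 1))) := by
        gcongr ENNReal.ofReal t * ?_
        exact setLIntegral_mono' measurableSet_Ioi hlevel
    _ = ENNReal.ofReal t * (2 * K * ((ENNReal.ofReal (t - 1))⁻¹ *
          ∫⁻ a, ENNReal.ofReal ((2 * f a) ^ (t - 1)) ∂ν)) := by
        rw [lintegral_const_mul' _ _ (by finiteness), hνint, ← mul_assoc (ENNReal.ofReal (t - 1))⁻¹,
          ENNReal.inv_mul_cancel (by simpa using ht) ENNReal.ofReal_ne_top, one_mul]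
    _ = _ := by rw [hνint']; ring

end StrongType

section Oscillation

variable [PseudoMetricSpace X] [MeasurableSpace X] {μ : Measure X}

theorem exists_mem_ball_gradient_le (hb : BallsPosFinite μ) {c Q q θ : ℝ} (hc : 0 < c)
    (hdim : DimLowerBound μ c Q) (hq : 0 < q) (hθ0 : 0 < θ) (hθ1 : θ < 1)
    (hθQ : θ ^ Q * 2 ^ q = 1) {g : X → ℝ} (hg : Measurable g)
    {E : Set X} (hE : μ E = 0) {x : X} {r T : ℝ} (hr : 0 < r) (hT : 0 < T)
    (hgint : ∫⁻ y in ball x (2 * r), ENNReal.ofReal (g y ^ q) ∂μ ≤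
      ENNReal.ofReal (c * ((1 - θ) / 2) ^ Q / 2 * T ^ q) * μ (ball x (2 * r)))
    (k : ℕ) {z : X} (hz : dist z x < r * (1 + θ ^ (k + 1))) :
    ∃ z' ∉ E, dist z' z < r * (1 - θ) * θ ^ k ∧ g z' ≤ 2 ^ k * T := by
  by_contra! hcon
  set d := r * (1 - θ) * θ ^ k with hd
  have hθ1' : 0 < 1 - θ := by linarith
  have hθk : 0 < θ ^ k := by positivity
  have hθk1 : θ ^ k ≤ 1 := pow_le_one₀ hθ0.le hθ1.le
  have hdpos : 0 < d := by positivity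
  have hdle : d + r * (1 + θ ^ (k + 1)) ≤ 2 * r := by
    have : d + r * (1 + θ ^ (k + 1)) = r * (1 + θ ^ k) := by rw [hd, pow_succ]; ring
    rw [this]
    nlinarith
  have hrθ : 0 < r * (1 + θ ^ (k + 1)) := by positivity
  have hzx : z ∈ ball x (2 * r) := mem_ball.2 (by linarith)
  have hlow := hdim x z d (2 * r) hdpos (by linarith) hzx
  obtain ⟨hm0, hmt⟩ := hb x (2 * r) (by linarith)
  have hsub : ball z d ⊆ E ∪ ({y | 2 ^ k * T < g y} ∩ ball x (2 * r)) := by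
    intro y hy
    by_cases hyE : y ∈ E
    · exact Or.inl hyE
    · refine Or.inr ⟨hcon y hyE hy, mem_ball.2 ?_⟩
      have := dist_triangle y z x
      have := mem_ball.1 hy
      linarith
  have hmeas : MeasurableSet {y | 2 ^ k * T < g y} := measurableSet_lt measurable_const hg
  have hle : μ (ball z d) ≤ μ ({y | 2 ^ k * T < g y} ∩ ball x (2 * r)) :=
    (measure_mono hsub).trans ((measure_union_le _ _).trans (by rw [hE, zero_add]))
  have hcheb : ENNReal.ofReal ((2 ^ k * T) ^ q) * μ ({y | 2 ^ k * T < g y} ∩ ball x (2 * r)) ≤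
      ∫⁻ y in ball x (2 * r), ENNReal.ofReal (g y ^ q) ∂μ := by
    rw [← Measure.restrict_apply hmeas]
    refine le_trans ?_ (mul_meas_ge_le_lintegral (by fun_prop) (ENNReal.ofReal ((2 ^ k * T) ^ q)))
    gcongr with y
    intro hy
    exact ENNReal.ofReal_le_ofReal (Real.rpow_le_rpow (by positivity) (le_of_lt hy) hq.le)
  have hfinal : ENNReal.ofReal ((2 ^ k * T) ^ q * (c * (d / (2 * r)) ^ Q)) * μ (ball x (2 * r)) ≤
      ENNReal.ofReal (c * ((1 - θ) / 2) ^ Q / 2 * T ^ q) * μ (ball x (2 * r)) := by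
    rw [ENNReal.ofReal_mul (by positivity), mul_assoc]
    exact (mul_le_mul_right (hlow.trans hle) _).trans (hcheb.trans hgint)
  rw [ENNReal.mul_le_mul_iff_left hm0 hmt, ENNReal.ofReal_le_ofReal_iff (by positivity)] at hfinal
  have hdr : d / (2 * r) = (1 - θ) / 2 * θ ^ k := by
    rw [hd]
    field_simp
  have h2 : ((2 : ℝ) ^ k) ^ q = ((2 : ℝ) ^ q) ^ k := by
    rw [← Real.rpow_natCast, ← Real.rpow_natCast, ← Real.rpow_mul (by norm_num),
      ← Real.rpow_mul (by norm_num), mul_comm]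
  have h3 : (θ ^ k) ^ Q = (θ ^ Q) ^ k := by
    rw [← Real.rpow_natCast, ← Real.rpow_natCast, ← Real.rpow_mul hθ0.le,
      ← Real.rpow_mul hθ0.le, mul_comm]
  have heq : (2 ^ k * T) ^ q * (c * (d / (2 * r)) ^ Q) = c * ((1 - θ) / 2) ^ Q * T ^ q := by
    rw [hdr, Real.mul_rpow (by positivity) hT.le, Real.mul_rpow (by positivity) (by positivity),
      h2, h3]
    have : (θ ^ Q) ^ k * ((2 : ℝ) ^ q) ^ k = 1 := by rw [← mul_pow, hθQ, one_pow]
    linear_combination (c * ((1 - θ) / 2) ^ Q * T ^ q) * this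
  rw [heq] at hfinal
  have : 0 < c * ((1 - θ) / 2) ^ Q * T ^ q := by positivity
  linarith

/-- A chaining estimate on the superlevel sets of a Hajłasz gradient. -/
theorem abs_sub_le_of_gradient_le (hb : BallsPosFinite μ) {c Q q θ s : ℝ} (hc : 0 < c)
    (hdim : DimLowerBound μ c Q) (hq : 0 < q) (hs : 0 ≤ s) (hθ0 : 0 < θ) (hθ1 : θ < 1)
    (hθQ : θ ^ Q * 2 ^ q = 1) (hθs : 2 * θ ^ s = 2 ^ q)
    {u g : X → ℝ} (hg : Measurable g) (hg0 : ∀ x, 0 ≤ g x)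
    {E : Set X} (hE : μ E = 0)
    (hug : ∀ x ∉ E, ∀ y ∉ E, |u x - u y| ≤ dist x y ^ s * (g x + g y))
    {x : X} (hx : x ∉ E) {r T : ℝ} (hr : 0 < r) (hT : 0 < T)
    (hgint : ∫⁻ y in ball x (2 * r), ENNReal.ofReal (g y ^ q) ∂μ ≤
      ENNReal.ofReal (c * ((1 - θ) / 2) ^ Q / 2 * T ^ q) * μ (ball x (2 * r)))
    (k : ℕ) : ∀ z ∉ E, dist z x < r * (1 + θ ^ k) → g z ≤ 2 ^ k * T →
      |u z - u x| ≤ (2 * r) ^ s * (g x + T) + 3 * r ^ s * T * (2 ^ q) ^ k / (2 ^ q - 1) := by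
  have hb1 : 0 < (2 : ℝ) ^ q - 1 := by linarith [Real.one_lt_rpow (by norm_num : (1 : ℝ) < 2) hq]
  induction k with
  | zero =>
    intro z hz hzx hgz
    have h1 : dist z x ≤ 2 * r := by
      rw [pow_zero] at hzx
      linarith
    rw [pow_zero, one_mul] at hgz
    calc |u z - u x| ≤ dist z x ^ s * (g z + g x) := hug z hz x hx
      _ ≤ (2 * r) ^ s * (g x + T) := by
        have := hg0 x
        have := hg0 z
        gcongr ?_ * ?_
        · exact Real.rpow_le_rpow dist_nonneg h1 hs
        · linarith
      _ ≤ _ := le_add_of_nonneg_right (by positivity)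
  | succ k ih =>
    intro z hz hzx hgz
    obtain ⟨z', hz', hzz', hgz'⟩ := exists_mem_ball_gradient_le hb hc hdim hq hθ0 hθ1 hθQ hg
      hE hr hT hgint k hzx
    have hθ1' : 0 < 1 - θ := by linarith
    have hθk : 0 < θ ^ k := by positivity
    have hz'x : dist z' x < r * (1 + θ ^ k) := by
      have := dist_triangle z' z x
      calc dist z' x < r * (1 - θ) * θ ^ k + r * (1 + θ ^ (k + 1)) := by linarith
        _ = r * (1 + θ ^ k) := by ring
    have h1 := ih z' hz' hz'x hgz'
    have h3 : (θ ^ k) ^ s = (θ ^ s) ^ k := by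
      rw [← Real.rpow_natCast, ← Real.rpow_natCast, ← Real.rpow_mul hθ0.le,
        ← Real.rpow_mul hθ0.le, mul_comm]
    have h2 : |u z - u z'| ≤ 3 * r ^ s * T * (2 ^ q) ^ k := by
      calc |u z - u z'| ≤ dist z z' ^ s * (g z + g z') := hug z hz z' hz'
        _ ≤ (r * θ ^ k) ^ s * (2 ^ (k + 1) * T + 2 ^ k * T) := by
          have := hg0 z
          have := hg0 z'
          gcongr ?_ * ?_
          · refine Real.rpow_le_rpow dist_nonneg ?_ hs
            rw [dist_comm]
            refine hzz'.le.trans ?_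
            have : r * (1 - θ) ≤ r := by nlinarith
            gcongr
          · linarith
        _ = 3 * r ^ s * T * (2 ^ q) ^ k := by
          rw [Real.mul_rpow hr.le hθk.le, h3, ← hθs, mul_pow]
          ring
    have h4 : 3 * r ^ s * T * (2 ^ q) ^ k + 3 * r ^ s * T * (2 ^ q) ^ k / (2 ^ q - 1) =
        3 * r ^ s * T * (2 ^ q) ^ (k + 1) / (2 ^ q - 1) := by
      field_simp
      ring
    have := abs_sub_le (u z) (u z') (u x)
    linarith

theorem abs_sub_le_add_rpow (hb : BallsPosFinite μ) {c Q q θ s : ℝ} (hc : 0 < c)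
    (hdim : DimLowerBound μ c Q) (hq : 0 < q) (hs : 0 ≤ s) (hθ0 : 0 < θ) (hθ1 : θ < 1)
    (hθQ : θ ^ Q * 2 ^ q = 1) (hθs : 2 * θ ^ s = 2 ^ q)
    {u g : X → ℝ} (hg : Measurable g) (hg0 : ∀ x, 0 ≤ g x)
    {E : Set X} (hE : μ E = 0)
    (hug : ∀ x ∉ E, ∀ y ∉ E, |u x - u y| ≤ dist x y ^ s * (g x + g y))
    {x : X} (hx : x ∉ E) {r T : ℝ} (hr : 0 < r) (hT : 0 < T)
    (hgint : ∫⁻ y in ball x (2 * r), ENNReal.ofReal (g y ^ q) ∂μ ≤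
      ENNReal.ofReal (c * ((1 - θ) / 2) ^ Q / 2 * T ^ q) * μ (ball x (2 * r)))
    {z : X} (hz : z ∉ E) (hzx : z ∈ ball x r) :
    |u z - u x| ≤ (2 * r) ^ s * (g x + T) +
      3 * r ^ s * T * 2 ^ q / (2 ^ q - 1) * (1 + g z ^ q / T ^ q) := by
  have hb1' := Real.one_lt_rpow (by norm_num : (1 : ℝ) < 2) hq
  have hb1 : 0 < (2 : ℝ) ^ q - 1 := by linarith
  have hex : ∃ k : ℕ, g z ≤ 2 ^ k * T := by
    obtain ⟨k, hk⟩ := pow_unbounded_of_one_lt (g z / T) (by norm_num : (1 : ℝ) < 2)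
    exact ⟨k, ((div_lt_iff₀ hT).1 hk).le⟩
  classical
  have hzx' : ∀ k : ℕ, dist z x < r * (1 + θ ^ k) := fun k => by
    have : 0 < r * θ ^ k := by positivity
    have := mem_ball.1 hzx
    linarith
  have hmain := abs_sub_le_of_gradient_le hb hc hdim hq hs hθ0 hθ1 hθQ hθs hg hg0 hE hug hx hr hT
    hgint (Nat.find hex) z hz (hzx' _) (Nat.find_spec hex)
  have hgT : 0 ≤ g z ^ q / T ^ q := div_nonneg (Real.rpow_nonneg (hg0 z) q) (by positivity)
  have hpow : ((2 : ℝ) ^ q) ^ Nat.find hex ≤ 2 ^ q * (1 + g z ^ q / T ^ q) := by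
    rcases Nat.eq_zero_or_eq_succ_pred (Nat.find hex) with h | h
    · rw [h, pow_zero]
      nlinarith
    · set m := (Nat.find hex).pred with hm
      have hlt : 2 ^ m * T < g z := not_le.1 (Nat.find_min hex (by omega))
      have h2 : ((2 : ℝ) ^ m) ^ q = ((2 : ℝ) ^ q) ^ m := by
        rw [← Real.rpow_natCast, ← Real.rpow_natCast, ← Real.rpow_mul (by norm_num),
          ← Real.rpow_mul (by norm_num), mul_comm]
      have h5 : ((2 : ℝ) ^ q) ^ m ≤ g z ^ q / T ^ q := by
        rw [le_div_iff₀ (by positivity), ← h2, ← Real.mul_rpow (by positivity) hT.le]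
        exact Real.rpow_le_rpow (by positivity) hlt.le hq.le
      rw [h, Nat.succ_eq_add_one, pow_succ']
      gcongr
      linarith
  refine hmain.trans ?_
  refine add_le_add le_rfl ?_
  calc 3 * r ^ s * T * (2 ^ q) ^ Nat.find hex / (2 ^ q - 1)
      ≤ 3 * r ^ s * T * (2 ^ q * (1 + g z ^ q / T ^ q)) / (2 ^ q - 1) := by gcongr
    _ = _ := by ring

theorem lintegral_abs_sub_le_of_le [OpensMeasurableSpace X] (hb : BallsPosFinite μ)
    {c Q q θ s : ℝ} (hc : 0 < c)
    (hdim : DimLowerBound μ c Q) (hq : 0 < q) (hs : 0 ≤ s) (hθ0 : 0 < θ) (hθ1 : θ < 1)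
    (hθQ : θ ^ Q * 2 ^ q = 1) (hθs : 2 * θ ^ s = 2 ^ q)
    {u g : X → ℝ} (hg : Measurable g) (hg0 : ∀ x, 0 ≤ g x)
    {E : Set X} (hE : μ E = 0)
    (hug : ∀ x ∉ E, ∀ y ∉ E, |u x - u y| ≤ dist x y ^ s * (g x + g y))
    {x : X} (hx : x ∉ E) {r T : ℝ} (hr : 0 < r) (hT : 0 < T)
    (hgint : ∫⁻ y in ball x (2 * r), ENNReal.ofReal (g y ^ q) ∂μ ≤
      ENNReal.ofReal (c * ((1 - θ) / 2) ^ Q / 2 * T ^ q) * μ (ball x (2 * r))) :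
    ∫⁻ z in ball x r, ENNReal.ofReal |u z - u x| ∂μ ≤
      ENNReal.ofReal ((2 ^ s + 3 * 2 ^ q / (2 ^ q - 1) * (1 + ((1 - θ) / 2) ^ Q / 2 * 2 ^ Q)) *
        r ^ s * (g x + T)) * μ (ball x r) := by
  have hb1' := Real.one_lt_rpow (by norm_num : (1 : ℝ) < 2) hq
  have hb1 : 0 < (2 : ℝ) ^ q - 1 := by linarith
  have hθ1' : 0 < 1 - θ := by linarith
  have hgx := hg0 x
  set κ := ((1 - θ) / 2) ^ Q / 2 with hκ
  have hκ0 : 0 < κ := by positivity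
  set D := 3 * r ^ s * T * 2 ^ q / (2 ^ q - 1) with hD
  have hD0 : 0 ≤ D := by positivity
  set P := (2 * r) ^ s * (g x + T) + D with hP
  have hP0 : 0 ≤ P := by positivity
  have hdouble : μ (ball x (2 * r)) ≤ ENNReal.ofReal (2 ^ Q / c) * μ (ball x r) := by
    have h := hdim x x r (2 * r) hr (by linarith) (mem_ball_self (by linarith))
    have h2 : r / (2 * r) = 2⁻¹ := by field_simp
    calc μ (ball x (2 * r))
        = ENNReal.ofReal (2 ^ Q / c) *
            (ENNReal.ofReal (c * (r / (2 * r)) ^ Q) * μ (ball x (2 * r))) := by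
          rw [← mul_assoc, ← ENNReal.ofReal_mul (by positivity), h2,
            Real.inv_rpow (by norm_num)]
          have : (2 : ℝ) ^ Q / c * (c * (2 ^ Q)⁻¹) = 1 := by
            have : (2 : ℝ) ^ Q ≠ 0 := by positivity
            field_simp
          rw [this, ENNReal.ofReal_one, one_mul]
      _ ≤ _ := by gcongr
  have hpt : ∀ᵐ z ∂μ.restrict (ball x r), ENNReal.ofReal |u z - u x| ≤
      ENNReal.ofReal P + ENNReal.ofReal (D / T ^ q) * ENNReal.ofReal (g z ^ q) := by
    have hEae : ∀ᵐ z ∂μ.restrict (ball x r), z ∉ E :=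
      ae_restrict_of_ae (measure_eq_zero_iff_ae_notMem.1 hE)
    filter_upwards [hEae, ae_restrict_mem measurableSet_ball] with z hz hzx
    have hgz : 0 ≤ g z ^ q := Real.rpow_nonneg (hg0 z) q
    rw [← ENNReal.ofReal_mul (by positivity), ← ENNReal.ofReal_add hP0 (by positivity)]
    refine ENNReal.ofReal_le_ofReal ((abs_sub_le_add_rpow hb hc hdim hq hs hθ0 hθ1 hθQ hθs hg hg0
      hE hug hx hr hT hgint hz hzx).trans_eq ?_)
    rw [hP]
    ring
  calc ∫⁻ z in ball x r, ENNReal.ofReal |u z - u x| ∂μ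
      ≤ ∫⁻ z in ball x r, (ENNReal.ofReal P +
          ENNReal.ofReal (D / T ^ q) * ENNReal.ofReal (g z ^ q)) ∂μ := lintegral_mono_ae hpt
    _ = ENNReal.ofReal P * μ (ball x r) + ENNReal.ofReal (D / T ^ q) *
          ∫⁻ z in ball x r, ENNReal.ofReal (g z ^ q) ∂μ := by
        rw [lintegral_add_left measurable_const, setLIntegral_const,
          lintegral_const_mul _ (by fun_prop)]
    _ ≤ ENNReal.ofReal P * μ (ball x r) + ENNReal.ofReal (D / T ^ q) *
          (ENNReal.ofReal (c * κ * T ^ q) * (ENNReal.ofReal (2 ^ Q / c) * μ (ball x r))) := by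
        refine add_le_add le_rfl (mul_le_mul_right ?_ _)
        refine (lintegral_mono_set (ball_subset_ball (by linarith))).trans (hgint.trans ?_)
        rw [hκ, ← mul_div_assoc]
        gcongr
    _ = ENNReal.ofReal (P + D * (κ * 2 ^ Q)) * μ (ball x r) := by
        rw [ENNReal.ofReal_add hP0 (by positivity), add_mul, ← mul_assoc, ← mul_assoc,
          ← ENNReal.ofReal_mul (by positivity), ← ENNReal.ofReal_mul (by positivity)]
        congr 3
        field_simp
    _ ≤ _ := by
        gcongr
        rw [hP, hD, Real.mul_rpow (by norm_num) hr.le]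
        have h : 0 ≤ 3 * 2 ^ q / (2 ^ q - 1) * (1 + κ * 2 ^ Q) * r ^ s * g x := by positivity
        have e : 3 * r ^ s * T * 2 ^ q / (2 ^ q - 1) = 3 * 2 ^ q / (2 ^ q - 1) * r ^ s * T := by
          ring
        rw [e]
        linarith

/-- A Sobolev--Poincaré type estimate for functions with a Hajłasz gradient. -/
theorem exists_lintegral_abs_sub_le [OpensMeasurableSpace X] (hb : BallsPosFinite μ) {c Q s : ℝ}
    (hc : 0 < c) (hQ : 0 < Q) (hdim : DimLowerBound μ c Q) (hs : 0 ≤ s) :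
    ∃ C : ℝ, 0 < C ∧ ∀ (u g : X → ℝ) (E : Set X), Measurable g → (∀ x, 0 ≤ g x) → μ E = 0 →
      (∀ x ∉ E, ∀ y ∉ E, |u x - u y| ≤ dist x y ^ s * (g x + g y)) → ∀ x ∉ E,
      uncenteredMax μ (fun y => ENNReal.ofReal (g y ^ (Q / (Q + s)))) x ≠ ⊤ → ∀ r : ℝ, 0 < r →
      ∫⁻ z in ball x r, ENNReal.ofReal |u z - u x| ∂μ ≤
        ENNReal.ofReal (C * r ^ s * (g x + (uncenteredMax μ
          (fun y => ENNReal.ofReal (g y ^ (Q / (Q + s)))) x).toReal ^ ((Q + s) / Q))) *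
          μ (ball x r) := by
  have hQs : 0 < Q + s := by linarith
  set q := Q / (Q + s) with hqdef
  have hq : 0 < q := by positivity
  set θ : ℝ := 2 ^ (-(1 / (Q + s))) with hθdef
  have hθ0 : 0 < θ := by positivity
  have hθ1 : θ < 1 := Real.rpow_lt_one_of_one_lt_of_neg (by norm_num) (by
    rw [neg_lt_zero]; positivity)
  have hθQ : θ ^ Q * 2 ^ q = 1 := by
    rw [hθdef, ← Real.rpow_mul (by norm_num), ← Real.rpow_add (by norm_num), hqdef]
    convert Real.rpow_zero 2 using 2
    field_simp
    ring
  have hθs : 2 * θ ^ s = 2 ^ q := by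
    rw [hθdef, ← Real.rpow_mul (by norm_num), hqdef]
    nth_rewrite 1 [← Real.rpow_one 2]
    rw [← Real.rpow_add (by norm_num)]
    congr 1
    field_simp
    ring
  have hθ1' : 0 < 1 - θ := by linarith
  have hb1 : 0 < (2 : ℝ) ^ q - 1 := by linarith [Real.one_lt_rpow (by norm_num : (1 : ℝ) < 2) hq]
  set κ := c * ((1 - θ) / 2) ^ Q / 2 with hκ
  have hκ0 : 0 < κ := by positivity
  set C₀ := 2 ^ s + 3 * 2 ^ q / (2 ^ q - 1) * (1 + ((1 - θ) / 2) ^ Q / 2 * 2 ^ Q) with hC₀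
  have hC₀pos : 0 < C₀ := by positivity
  set w := (κ⁻¹) ^ ((Q + s) / Q) with hw
  have hwpos : 0 < w := by positivity
  refine ⟨C₀ * (1 + w), by positivity, ?_⟩
  intro u g E hg hg0 hE hug x hx hMx r hr
  set m := (uncenteredMax μ (fun y => ENNReal.ofReal (g y ^ q)) x).toReal with hm
  have hm0 : 0 ≤ m := ENNReal.toReal_nonneg
  have hgx := hg0 x
  set T₀ := (κ⁻¹ * m) ^ ((Q + s) / Q) with hT₀
  have hT₀0 : 0 ≤ T₀ := by positivity
  have hT₀q : κ * T₀ ^ q = m := by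
    rw [hT₀, ← Real.rpow_mul (by positivity), hqdef, div_mul_div_cancel₀ hQ.ne',
      div_self hQs.ne', Real.rpow_one]
    field_simp
  have hε : ∀ ε : ℝ, 0 < ε → ∫⁻ z in ball x r, ENNReal.ofReal |u z - u x| ∂μ ≤
      ENNReal.ofReal (C₀ * r ^ s * (g x + (T₀ + ε))) * μ (ball x r) := by
    intro ε hε
    refine lintegral_abs_sub_le_of_le hb hc hdim hq hs hθ0 hθ1 hθQ hθs hg hg0 hE hug hx hr
      (by positivity) ?_
    refine (lintegral_ball_le_uncenteredMax_mul hb _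
      (mem_ball_self (by linarith : 0 < 2 * r))).trans ?_
    rw [← ENNReal.ofReal_toReal hMx]
    gcongr
    rw [← hm, ← hT₀q]
    gcongr
    linarith
  have hlim : Filter.Tendsto (fun ε : ℝ => ENNReal.ofReal (C₀ * r ^ s * (g x + (T₀ + ε))) *
      μ (ball x r)) (nhdsWithin 0 (Set.Ioi 0))
      (nhds (ENNReal.ofReal (C₀ * r ^ s * (g x + (T₀ + 0))) * μ (ball x r))) := by
    refine ENNReal.Tendsto.mul_const (ENNReal.tendsto_ofReal ?_) (Or.inr (hb x r hr).2)
    exact tendsto_nhdsWithin_of_tendsto_nhds (Continuous.tendsto (by fun_prop) 0)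
  refine (ge_of_tendsto hlim (Filter.eventually_of_mem self_mem_nhdsWithin
    fun ε h => hε ε h)).trans ?_
  refine mul_le_mul_left (ENNReal.ofReal_le_ofReal ?_) _
  rw [hT₀, Real.mul_rpow (by positivity) hm0, ← hw, add_zero]
  have h1 : 0 ≤ w * g x := by positivity
  have h2 : 0 ≤ m ^ ((Q + s) / Q) := by positivity
  have h3 : g x + w * m ^ ((Q + s) / Q) ≤ (1 + w) * (g x + m ^ ((Q + s) / Q)) := by linarith
  calc _ ≤ C₀ * r ^ s * ((1 + w) * (g x + m ^ ((Q + s) / Q))) := by gcongr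
    _ = _ := by ring

end Oscillation

theorem DiscreteMaxData.exists_finset_near [PseudoMetricSpace X] (D : DiscreteMaxData X) {r : ℚ}
    (hr : 0 < r) (x : X) :
    ∃ I : Finset ℕ, I.card ≤ D.N ∧ ∀ i, i ∈ I ↔ x ∈ ball (D.center r i) (6 * (r : ℝ)) := by
  set S : Set ℕ := {i | x ∈ ball (D.center r i) (6 * (r : ℝ))} with hS
  have hcard : S.encard ≤ D.N := by
    have h := D.overlap r hr x
    have h2 : ∑' i : ℕ, (ball (D.center r i) (6 * (r : ℝ))).indicator (fun _ => (1 : ℝ≥0∞)) x =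
        S.encard := by
      rw [← ENNReal.tsum_set_one, tsum_subtype S fun _ => (1 : ℝ≥0∞)]
      rfl
    rw [h2] at h
    exact_mod_cast h
  have hfin : S.Finite := Set.finite_of_encard_le_coe hcard
  refine ⟨hfin.toFinset, ?_, fun i => by rw [hfin.mem_toFinset]; rfl⟩
  rw [hfin.encard_eq_coe_toFinset_card] at hcard
  exact_mod_cast hcard

theorem DiscreteMaxData.sum_φ_eq_one [PseudoMetricSpace X] (D : DiscreteMaxData X) {r : ℚ}
    (hr : 0 < r) {x : X} {I : Finset ℕ}
    (hI : ∀ i, x ∈ ball (D.center r i) (6 * (r : ℝ)) → i ∈ I) :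
    ∑ i ∈ I, D.φ r i x = 1 := by
  rw [← D.φ_sum r hr x, tsum_eq_sum]
  exact fun i hi => D.φ_supp r hr i x fun h => hi (hI i h)

section DiscreteConvolution

variable [PseudoMetricSpace X] [MeasurableSpace X] {μ : Measure X}

/-- The mean oscillation of `u` around its value at `x` is at most `A * ρ ^ s` at every
scale `ρ`. -/
def OscillationBound (μ : Measure X) (s : ℝ) (u : X → ℝ) (A : ℝ) (x : X) : Prop :=
  ∀ ρ : ℝ, 0 < ρ → ∫⁻ z in ball x ρ, ENNReal.ofReal |u z - u x| ∂μ ≤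
    ENNReal.ofReal (A * ρ ^ s) * μ (ball x ρ)

/-- The discrete convolution of `|u|` at scale `3r`. -/
noncomputable def DiscreteMaxData.discreteConv (D : DiscreteMaxData X) (μ : Measure X)
    (u : X → ℝ) (r : ℚ) (x : X) : ℝ≥0∞ :=
  ∑' i : ℕ, ENNReal.ofReal (D.φ r i x) * ⨍⁻ y in ball (D.center r i) (3 * (r : ℝ)), ‖u y‖₊ ∂μ

theorem OscillationBound.laverage_near (hb : BallsPosFinite μ) {c Q s : ℝ} (hc : 0 < c)
    (hdim : DimLowerBound μ c Q) {u : X → ℝ} (hu : AEMeasurable u μ) {A : ℝ} (hA : 0 ≤ A) {x : X}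
    (h : OscillationBound μ s u A x) {r : ℝ} (hr : 0 < r) {z : X} (hz : dist z x < 7 * r) :
    (⨍⁻ y in ball z (3 * r), ‖u y‖₊ ∂μ) ≠ ⊤ ∧
      abs ((⨍⁻ y in ball z (3 * r), ‖u y‖₊ ∂μ).toReal - |u x|)
        ≤ 10 ^ s * (c * (3 / 10) ^ Q)⁻¹ * A * r ^ s := by
  set e := 10 ^ s * (c * (3 / 10) ^ Q)⁻¹ * A * r ^ s with he
  have he0 : 0 ≤ e := by positivity
  obtain ⟨hm0, hmt⟩ := hb z (3 * r) (by linarith)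
  have hosc : ∫⁻ y in ball z (3 * r), ENNReal.ofReal |u y - u x| ∂μ ≤
      ENNReal.ofReal e * μ (ball z (3 * r)) := by
    have hsub : ball z (3 * r) ⊆ ball x (10 * r) := ball_subset_ball' (by linarith)
    have hd := hdim x z (3 * r) (10 * r) (by linarith) (by linarith) (mem_ball.2 (by linarith))
    have h310 : 3 * r / (10 * r) = 3 / 10 := by field_simp
    rw [h310] at hd
    calc ∫⁻ y in ball z (3 * r), ENNReal.ofReal |u y - u x| ∂μ
        ≤ ENNReal.ofReal (A * (10 * r) ^ s) * μ (ball x (10 * r)) :=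
          (lintegral_mono_set hsub).trans (h _ (by linarith))
      _ = ENNReal.ofReal e * (ENNReal.ofReal (c * (3 / 10) ^ Q) * μ (ball x (10 * r))) := by
          rw [← mul_assoc, ← ENNReal.ofReal_mul he0, he, Real.mul_rpow (by norm_num) hr.le]
          congr 2
          have : (3 / 10 : ℝ) ^ Q ≠ 0 := by positivity
          field_simp
      _ ≤ _ := by gcongr
  have hnorm : ∀ y, (‖u y‖₊ : ℝ≥0∞) = ENNReal.ofReal |u y| := fun y => by
    rw [← Real.norm_eq_abs, ofReal_norm, enorm_eq_nnnorm]
  simp only [hnorm]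
  set a := ⨍⁻ y in ball z (3 * r), ENNReal.ofReal |u y| ∂μ with ha
  have hupper : a ≤ ENNReal.ofReal (|u x| + e) := by
    rw [ha, setLAverage_eq, ENNReal.div_le_iff hm0 hmt,
      ENNReal.ofReal_add (abs_nonneg _) he0, add_mul]
    calc ∫⁻ y in ball z (3 * r), ENNReal.ofReal |u y| ∂μ
        ≤ ∫⁻ y in ball z (3 * r), (ENNReal.ofReal |u x| + ENNReal.ofReal |u y - u x|) ∂μ := by
          refine lintegral_mono fun y => ?_
          rw [← ENNReal.ofReal_add (abs_nonneg _) (abs_nonneg _)]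
          refine ENNReal.ofReal_le_ofReal ?_
          have := abs_add_le (u x) (u y - u x)
          rwa [add_sub_cancel] at this
      _ ≤ _ := by
          rw [lintegral_add_left measurable_const, setLIntegral_const]
          gcongr
  have hatop : a ≠ ⊤ := ne_top_of_le_ne_top ENNReal.ofReal_ne_top hupper
  have hlower : ENNReal.ofReal |u x| ≤ a + ENNReal.ofReal e := by
    have : ENNReal.ofReal |u x| * μ (ball z (3 * r)) ≤
        (a + ENNReal.ofReal e) * μ (ball z (3 * r)) := by
      rw [add_mul, ha, setLAverage_eq, ENNReal.div_mul_cancel hm0 hmt, ← setLIntegral_const]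
      calc ∫⁻ _ in ball z (3 * r), ENNReal.ofReal |u x| ∂μ
          ≤ ∫⁻ y in ball z (3 * r), (ENNReal.ofReal |u y| + ENNReal.ofReal |u y - u x|) ∂μ := by
            refine lintegral_mono fun y => ?_
            rw [← ENNReal.ofReal_add (abs_nonneg _) (abs_nonneg _)]
            refine ENNReal.ofReal_le_ofReal ?_
            have := abs_sub_abs_le_abs_sub (u x) (u y)
            rw [abs_sub_comm] at this
            linarith
        _ ≤ _ := by
            rw [lintegral_add_left' (by fun_prop)]
            gcongr
    rwa [ENNReal.mul_le_mul_iff_left hm0 hmt] at this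
  refine ⟨hatop, abs_sub_le_iff.2 ⟨?_, ?_⟩⟩
  · have := ENNReal.toReal_le_of_le_ofReal (by positivity) hupper
    linarith
  · rw [← ENNReal.ofReal_toReal hatop, ← ENNReal.ofReal_add ENNReal.toReal_nonneg he0,
      ENNReal.ofReal_le_ofReal_iff (by positivity)] at hlower
    linarith

theorem DiscreteMaxData.discreteConv_eq_sum (D : DiscreteMaxData X) {u : X → ℝ} {r : ℚ}
    (hr : 0 < r) {x : X} {I : Finset ℕ}
    (hI : ∀ i, x ∈ ball (D.center r i) (6 * (r : ℝ)) → i ∈ I)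
    (hfin : ∀ i ∈ I, (⨍⁻ y in ball (D.center r i) (3 * (r : ℝ)), ‖u y‖₊ ∂μ) ≠ ⊤) :
    D.discreteConv μ u r x = ENNReal.ofReal (∑ i ∈ I, D.φ r i x *
      (⨍⁻ y in ball (D.center r i) (3 * (r : ℝ)), ‖u y‖₊ ∂μ).toReal) := by
  rw [discreteConv, tsum_eq_sum (s := I), ENNReal.ofReal_sum_of_nonneg]
  · refine Finset.sum_congr rfl fun i hi => ?_
    rw [ENNReal.ofReal_mul (D.φ_nonneg r i x), ENNReal.ofReal_toReal (hfin i hi)]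
  · exact fun i _ => mul_nonneg (D.φ_nonneg r i x) ENNReal.toReal_nonneg
  · intro i hi
    rw [D.φ_supp r hr i x fun h => hi (hI i h), ENNReal.ofReal_zero, zero_mul]

/-- At a point of bounded oscillation the discrete convolution is close to `|u|`. -/
theorem OscillationBound.discreteConv_near (D : DiscreteMaxData X) (hb : BallsPosFinite μ)
    {c Q s : ℝ} (hc : 0 < c) (hdim : DimLowerBound μ c Q) {u : X → ℝ} (hu : AEMeasurable u μ)
    {A : ℝ} (hA : 0 ≤ A) {x : X} (h : OscillationBound μ s u A x) {r : ℚ} (hr : 0 < r) :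
    D.discreteConv μ u r x ≠ ⊤ ∧ abs ((D.discreteConv μ u r x).toReal - |u x|)
        ≤ 10 ^ s * (c * (3 / 10) ^ Q)⁻¹ * A * (r : ℝ) ^ s := by
  have hr' : (0 : ℝ) < r := by exact_mod_cast hr
  obtain ⟨I, -, hI⟩ := D.exists_finset_near hr x
  have hnear : ∀ i ∈ I, dist (D.center r i) x < 7 * (r : ℝ) := fun i hi => by
    have := mem_ball'.1 ((hI i).1 hi)
    linarith
  have hav := fun i hi => h.laverage_near hb hc hdim hu hA hr' (hnear i hi)
  have hsum := D.sum_φ_eq_one hr fun i => (hI i).2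
  rw [D.discreteConv_eq_sum hr (fun i => (hI i).2) fun i hi => (hav i hi).1]
  refine ⟨ENNReal.ofReal_ne_top, ?_⟩
  rw [ENNReal.toReal_ofReal (Finset.sum_nonneg fun i _ =>
    mul_nonneg (D.φ_nonneg r i x) ENNReal.toReal_nonneg)]
  set e := 10 ^ s * (c * (3 / 10) ^ Q)⁻¹ * A * (r : ℝ) ^ s with he
  calc _ = |∑ i ∈ I, D.φ r i x *
        ((⨍⁻ y in ball (D.center r i) (3 * (r : ℝ)), ‖u y‖₊ ∂μ).toReal - |u x|)| := by
        simp_rw [mul_sub, Finset.sum_sub_distrib, ← Finset.sum_mul, hsum, one_mul]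
    _ ≤ ∑ i ∈ I, D.φ r i x * e := by
        refine (Finset.abs_sum_le_sum_abs _ _).trans (Finset.sum_le_sum fun i hi => ?_)
        rw [abs_mul, abs_of_nonneg (D.φ_nonneg r i x)]
        exact mul_le_mul_of_nonneg_left (hav i hi).2 (D.φ_nonneg r i x)
    _ = e := by rw [← Finset.sum_mul, hsum, one_mul]

/-- Lipschitz estimate for the discrete convolution at scales larger than the distance. -/
theorem OscillationBound.discreteConv_le_add (D : DiscreteMaxData X) (hb : BallsPosFinite μ)
    {c Q s : ℝ} (hc : 0 < c) (hdim : DimLowerBound μ c Q) {u : X → ℝ} (hu : AEMeasurable u μ)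
    {A : ℝ} (hA : 0 ≤ A) {x y : X} (h : OscillationBound μ s u A x) {r : ℚ} (hr : 0 < r)
    (hxy : dist x y ≤ r) :
    D.discreteConv μ u r x ≤ D.discreteConv μ u r y + ENNReal.ofReal (2 * D.N *
      (D.L / r * dist x y * (10 ^ s * (c * (3 / 10) ^ Q)⁻¹ * A * (r : ℝ) ^ s))) := by
  classical
  have hr' : (0 : ℝ) < r := by exact_mod_cast hr
  have hL := D.L_pos
  obtain ⟨I, hIc, hI⟩ := D.exists_finset_near hr x
  obtain ⟨J, hJc, hJ⟩ := D.exists_finset_near hr y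
  have hnear : ∀ i ∈ I ∪ J, dist (D.center r i) x < 7 * (r : ℝ) := fun i hi => by
    rcases Finset.mem_union.1 hi with hi | hi
    · have := mem_ball'.1 ((hI i).1 hi)
      linarith
    · have := mem_ball'.1 ((hJ i).1 hi)
      have := dist_triangle (D.center r i) y x
      rw [dist_comm y x] at this
      linarith
  have hcard : ((I ∪ J).card : ℝ) ≤ 2 * D.N := by
    have := Finset.card_union_le I J
    exact_mod_cast (by omega : (I ∪ J).card ≤ 2 * D.N)
  have hIx : ∀ i, x ∈ ball (D.center r i) (6 * (r : ℝ)) → i ∈ I ∪ J :=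
    fun i hi => Finset.mem_union_left _ ((hI i).2 hi)
  have hJy : ∀ i, y ∈ ball (D.center r i) (6 * (r : ℝ)) → i ∈ I ∪ J :=
    fun i hi => Finset.mem_union_right _ ((hJ i).2 hi)
  have hav := fun i hi => h.laverage_near hb hc hdim hu hA hr' (hnear i hi)
  have hsumx := D.sum_φ_eq_one hr hIx
  have hsumy := D.sum_φ_eq_one hr hJy
  rw [D.discreteConv_eq_sum hr hIx fun i hi => (hav i hi).1,
    D.discreteConv_eq_sum hr hJy fun i hi => (hav i hi).1]
  set e := 10 ^ s * (c * (3 / 10) ^ Q)⁻¹ * A * (r : ℝ) ^ s with he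
  have he0 : 0 ≤ e := by positivity
  rw [← ENNReal.ofReal_add (Finset.sum_nonneg fun i _ =>
    mul_nonneg (D.φ_nonneg r i y) ENNReal.toReal_nonneg) (by positivity)]
  refine ENNReal.ofReal_le_ofReal ?_
  rw [← sub_le_iff_le_add']
  calc _ = ∑ i ∈ I ∪ J, (D.φ r i x - D.φ r i y) *
        ((⨍⁻ z in ball (D.center r i) (3 * (r : ℝ)), ‖u z‖₊ ∂μ).toReal - |u x|) := by
        simp_rw [mul_sub, sub_mul, Finset.sum_sub_distrib, ← Finset.sum_mul, hsumx, hsumy]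
        ring
    _ ≤ ∑ i ∈ I ∪ J, D.L / r * dist x y * e := by
        refine Finset.sum_le_sum fun i hi => (le_abs_self _).trans ?_
        rw [abs_mul]
        have hlip := (D.φ_lip r hr i).dist_le_mul x y
        rw [Real.coe_toNNReal _ (by positivity), Real.dist_eq] at hlip
        exact mul_le_mul hlip (hav i hi).2 (abs_nonneg _) (by positivity)
    _ = (I ∪ J).card * (D.L / r * dist x y * e) := by rw [Finset.sum_const, nsmul_eq_mul]
    _ ≤ _ := by gcongr

end DiscreteConvolution

section MaximalFunction

variable [PseudoMetricSpace X] [MeasurableSpace X] {μ : Measure X}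

theorem DiscreteMaxData.mul_discreteConv_le_dMax (D : DiscreteMaxData X) (α : ℝ) (u : X → ℝ)
    {r : ℚ} (hr : 0 < r) (x : X) :
    ENNReal.ofReal ((r : ℝ) ^ α) * D.discreteConv μ u r x ≤ D.dMax μ α u x :=
  le_iSup_of_le (f := fun r : ℚ => ⨆ _ : 0 < r, ENNReal.ofReal ((r : ℝ) ^ α) *
    D.discreteConv μ u r x) r (le_iSup_of_le hr le_rfl)

theorem DiscreteMaxData.dMax_le (D : DiscreteMaxData X) {α : ℝ} {u : X → ℝ} {x : X} {b : ℝ≥0∞}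
    (h : ∀ r : ℚ, 0 < r → ENNReal.ofReal ((r : ℝ) ^ α) * D.discreteConv μ u r x ≤ b) :
    D.dMax μ α u x ≤ b :=
  iSup_le fun r => iSup_le fun hr => h r hr

theorem OscillationBound.mul_discreteConv_le_of_dist_le (D : DiscreteMaxData X)
    (hb : BallsPosFinite μ) {c Q s α : ℝ} (hc : 0 < c) (hdim : DimLowerBound μ c Q)
    (hsα1 : s + α ≤ 1) {u : X → ℝ} (hu : AEMeasurable u μ)
    {A : ℝ} (hA : 0 ≤ A) {x y : X} (h : OscillationBound μ s u A x) {r : ℚ} (hr : 0 < r)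
    (hxy : dist x y ≤ r) :
    ENNReal.ofReal ((r : ℝ) ^ α) * D.discreteConv μ u r x ≤ D.dMax μ α u y +
      ENNReal.ofReal (2 * D.N * D.L * (10 ^ s * (c * (3 / 10) ^ Q)⁻¹) *
        dist x y ^ (s + α) * A) := by
  have hr' : (0 : ℝ) < r := by exact_mod_cast hr
  have hL := D.L_pos
  set K := 10 ^ s * (c * (3 / 10) ^ Q)⁻¹ with hK
  have hK0 : 0 < K := by positivity
  calc _ ≤ ENNReal.ofReal ((r : ℝ) ^ α) * (D.discreteConv μ u r y + ENNReal.ofReal (2 * D.N *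
      (D.L / r * dist x y * (K * A * (r : ℝ) ^ s)))) := by
        gcongr
        exact h.discreteConv_le_add D hb hc hdim hu hA hr hxy
    _ = ENNReal.ofReal ((r : ℝ) ^ α) * D.discreteConv μ u r y + ENNReal.ofReal ((r : ℝ) ^ α *
      (2 * D.N * (D.L / r * dist x y * (K * A * (r : ℝ) ^ s)))) := by
        rw [mul_add, ← ENNReal.ofReal_mul (by positivity)]
    _ ≤ _ := by
        gcongr ?_ + ENNReal.ofReal ?_
        · exact D.mul_discreteConv_le_dMax α u hr y
        · have hscale : (r : ℝ) ^ α * (r : ℝ) ^ s * (dist x y / r) ≤ dist x y ^ (s + α) := by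
            rw [← Real.rpow_add hr', add_comm α s]
            rcases (dist_nonneg (x := x) (y := y)).eq_or_lt with h0 | h0
            · rw [← h0, zero_div, mul_zero]
              positivity
            · have h1 : dist x y / r ≤ (dist x y / r) ^ (s + α) := by
                have := Real.rpow_le_rpow_of_exponent_ge (div_pos h0 hr')
                  ((div_le_one hr').2 hxy) hsα1
                rwa [Real.rpow_one] at this
              calc (r : ℝ) ^ (s + α) * (dist x y / r)
                  ≤ (r : ℝ) ^ (s + α) * (dist x y / r) ^ (s + α) := by gcongr
                _ = dist x y ^ (s + α) := by
                  rw [← Real.mul_rpow hr'.le (by positivity), mul_div_cancel₀ _ hr'.ne']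
          calc _ = 2 * D.N * D.L * K * ((r : ℝ) ^ α * (r : ℝ) ^ s * (dist x y / r)) * A := by ring
            _ ≤ _ := by gcongr

theorem OscillationBound.dMax_ne_top (D : DiscreteMaxData X)
    (hb : BallsPosFinite μ) {c Q s α : ℝ} (hc : 0 < c) (hdim : DimLowerBound μ c Q)
    (hs : 0 ≤ s) (hα : 0 ≤ α)
    (hsα1 : s + α ≤ 1) {u : X → ℝ} (hu : AEMeasurable u μ)
    {A : ℝ} (hA : 0 ≤ A) {x y : X} (h : OscillationBound μ s u A x) (hy : D.dMax μ α u y ≠ ⊤) :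
    D.dMax μ α u x ≠ ⊤ := by
  set K := 10 ^ s * (c * (3 / 10) ^ Q)⁻¹ with hK
  have hK0 : 0 < K := by positivity
  refine ne_top_of_le_ne_top (b := D.dMax μ α u y + ENNReal.ofReal (2 * D.N * D.L * K *
    dist x y ^ (s + α) * A) + ENNReal.ofReal (dist x y ^ α * (|u x| + K * A * dist x y ^ s)))
    (by finiteness) (D.dMax_le fun r hr => ?_)
  have hr' : (0 : ℝ) < r := by exact_mod_cast hr
  rcases le_or_gt (dist x y) r with hxy | hxy
  · exact (h.mul_discreteConv_le_of_dist_le D hb hc hdim hsα1 hu hA hr hxy).trans le_self_add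
  · refine le_trans ?_ le_add_self
    obtain ⟨hfin, hle⟩ := h.discreteConv_near D hb hc hdim hu hA hr
    rw [← ENNReal.ofReal_toReal hfin, ← ENNReal.ofReal_mul (by positivity)]
    refine ENNReal.ofReal_le_ofReal ?_
    gcongr
    have h1 : (r : ℝ) ^ s ≤ dist x y ^ s := Real.rpow_le_rpow hr'.le hxy.le hs
    have h2 : K * A * (r : ℝ) ^ s ≤ K * A * dist x y ^ s := by gcongr
    linarith [(abs_le.1 hle).2]

theorem OscillationBound.dMax_le_add (D : DiscreteMaxData X)
    (hb : BallsPosFinite μ) {c Q s α : ℝ} (hc : 0 < c) (hdim : DimLowerBound μ c Q)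
    (hs : 0 ≤ s) (hα : 0 ≤ α)
    (hsα1 : s + α ≤ 1) {u : X → ℝ} (hu : AEMeasurable u μ)
    {A B : ℝ} (hA : 0 ≤ A) (hB : 0 ≤ B) {x y : X} (hx : OscillationBound μ s u A x)
    (hy : OscillationBound μ s u B y) (hxy0 : 0 < dist x y)
    (hxy : |u x - u y| ≤ dist x y ^ s * (A + B)) :
    D.dMax μ α u x ≤ D.dMax μ α u y + ENNReal.ofReal
      ((2 * D.N * D.L * (10 ^ s * (c * (3 / 10) ^ Q)⁻¹) +
        2 * (2 * (10 ^ s * (c * (3 / 10) ^ Q)⁻¹) + 1)) * dist x y ^ (s + α) * (A + B)) := by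
  have hL := D.L_pos
  set K := 10 ^ s * (c * (3 / 10) ^ Q)⁻¹ with hK
  have hK0 : 0 < K := by positivity
  set d := dist x y with hd
  refine D.dMax_le fun r hr => ?_
  have hr' : (0 : ℝ) < r := by exact_mod_cast hr
  rcases le_or_gt d r with hdr | hdr
  · refine (hx.mul_discreteConv_le_of_dist_le D hb hc hdim hsα1 hu hA hr hdr).trans ?_
    gcongr D.dMax μ α u y + ENNReal.ofReal (?_ * _ * ?_)
    · exact le_add_of_nonneg_right (by positivity)
    · linarith
  · obtain ⟨t, ht1, ht2⟩ := exists_rat_btwn (show d < 2 * d by linarith)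
    have ht' : (0 : ℝ) < t := hxy0.trans ht1
    have ht : 0 < t := by exact_mod_cast ht'
    obtain ⟨hxfin, hxle⟩ := hx.discreteConv_near D hb hc hdim hu hA hr
    obtain ⟨hyfin, hyle⟩ := hy.discreteConv_near D hb hc hdim hu hB ht
    have htwo : ∀ β : ℝ, 0 ≤ β → β ≤ 1 → (t : ℝ) ^ β ≤ 2 * d ^ β := fun β h0 h1 =>
      calc (t : ℝ) ^ β ≤ (2 * d) ^ β := Real.rpow_le_rpow ht'.le ht2.le h0
        _ = 2 ^ β * d ^ β := Real.mul_rpow (by norm_num) hxy0.le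
        _ ≤ 2 * d ^ β := by
          gcongr
          exact Real.rpow_le_self_of_one_le (by norm_num) h1
    have hrs : (r : ℝ) ^ s ≤ d ^ s := Real.rpow_le_rpow hr'.le hdr.le hs
    have hrα : (r : ℝ) ^ α ≤ (t : ℝ) ^ α := Real.rpow_le_rpow hr'.le (hdr.trans ht1).le hα
    have hconv : (D.discreteConv μ u r x).toReal ≤ (D.discreteConv μ u t y).toReal +
        (2 * K + 1) * (d ^ s * (A + B)) := by
      have h1 : K * A * (r : ℝ) ^ s ≤ K * A * d ^ s := by gcongr
      have h2 : K * B * (t : ℝ) ^ s ≤ K * B * (2 * d ^ s) := by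
        gcongr
        exact htwo s hs (by linarith)
      have h3 := abs_sub_abs_le_abs_sub (u x) (u y)
      have h4 := (abs_le.1 hxle).2
      have h5 := (abs_le.1 hyle).1
      have h6 : 0 ≤ K * A * d ^ s := by positivity
      linarith
    refine le_trans ?_ (add_le_add (D.mul_discreteConv_le_dMax α u ht y) le_rfl)
    rw [← ENNReal.ofReal_toReal hxfin, ← ENNReal.ofReal_toReal hyfin,
      ← ENNReal.ofReal_mul (by positivity), ← ENNReal.ofReal_mul (by positivity),
      ← ENNReal.ofReal_add (by positivity) (by positivity)]
    refine ENNReal.ofReal_le_ofReal ?_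
    calc (r : ℝ) ^ α * (D.discreteConv μ u r x).toReal
        ≤ (t : ℝ) ^ α * ((D.discreteConv μ u t y).toReal +
          (2 * K + 1) * (d ^ s * (A + B))) := by gcongr
      _ = (t : ℝ) ^ α * (D.discreteConv μ u t y).toReal +
          (t : ℝ) ^ α * ((2 * K + 1) * (d ^ s * (A + B))) := by ring
      _ ≤ (t : ℝ) ^ α * (D.discreteConv μ u t y).toReal +
          2 * d ^ α * ((2 * K + 1) * (d ^ s * (A + B))) := by
          gcongr
          exact htwo α hα (by linarith)
      _ = (t : ℝ) ^ α * (D.discreteConv μ u t y).toReal +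
          2 * (2 * K + 1) * d ^ (s + α) * (A + B) := by
          rw [Real.rpow_add hxy0]
          ring
      _ ≤ _ := by
          gcongr
          exact le_add_of_nonneg_left (by positivity)

end MaximalFunction

section Boundedness

theorem DimLowerBound.measure_ball_five_mul_le [PseudoMetricSpace X] [MeasurableSpace X]
    {μ : Measure X} {c Q : ℝ} (hc : 0 < c) (hdim : DimLowerBound μ c Q) (x : X) {r : ℝ}
    (hr : 0 < r) : μ (ball x (5 * r)) ≤ ENNReal.ofReal (c * (1 / 5) ^ Q)⁻¹ * μ (ball x r) := by
  have h := hdim x x r (5 * r) hr (by linarith) (mem_ball_self (by linarith))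
  have h5 : r / (5 * r) = 1 / 5 := by field_simp
  rw [h5] at h
  have hpos : 0 < c * (1 / 5) ^ Q := by positivity
  calc μ (ball x (5 * r))
      = ENNReal.ofReal (c * (1 / 5) ^ Q)⁻¹ *
          (ENNReal.ofReal (c * (1 / 5) ^ Q) * μ (ball x (5 * r))) := by
        rw [← mul_assoc, ← ENNReal.ofReal_mul (by positivity), inv_mul_cancel₀ hpos.ne',
          ENNReal.ofReal_one, one_mul]
    _ ≤ _ := by gcongr

theorem DiscreteMaxData.secondCountableTopology [PseudoMetricSpace X] (D : DiscreteMaxData X) :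
    SecondCountableTopology X := by
  have hdense : DenseRange fun a : ℚ × ℕ => D.center a.1 a.2 := by
    refine Metric.dense_iff.2 fun x ε hε => ?_
    obtain ⟨r, hr0, hrε⟩ := exists_rat_btwn hε
    obtain ⟨i, hi⟩ := D.cover r (by exact_mod_cast hr0) x
    exact ⟨D.center r i, mem_ball'.2 ((mem_ball.1 hi).trans hrε), ⟨(r, i), rfl⟩⟩
  have : TopologicalSpace.SeparableSpace X :=
    ⟨⟨_, Set.countable_range _, hdense⟩⟩
  exact UniformSpace.secondCountable_of_separable X

theorem DiscreteMaxData.measure_eq_zero [PseudoMetricSpace X] [MeasurableSpace X]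
    (D : DiscreteMaxData X) {μ : Measure X} (h : ∀ x : X, μ (ball x 1) = 0) : μ = 0 := by
  rw [← Measure.measure_univ_eq_zero]
  refine measure_mono_null (fun x _ => ?_)
    (measure_iUnion_null fun i => h (D.center 1 i))
  obtain ⟨i, hi⟩ := D.cover 1 one_pos x
  exact Set.mem_iUnion.2 ⟨i, by simpa using hi⟩

theorem DimLowerBound.trichotomy [PseudoMetricSpace X] [MeasurableSpace X] {μ : Measure X}
    {c Q : ℝ} (hc : 0 < c) (hdim : DimLowerBound μ c Q) :
    BallsPosFinite μ ∨ (∀ (x : X) (r : ℝ), 0 < r → μ (ball x r) = 0) ∨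
      ∀ (x : X) (r : ℝ), 0 < r → μ (ball x r) = ⊤ := by
  by_cases h0 : ∃ (x : X) (r : ℝ), 0 < r ∧ μ (ball x r) = 0
  · obtain ⟨x, r, hr, hx⟩ := h0
    refine Or.inr (Or.inl fun y ρ hρ => ?_)
    set R := r + ρ + dist x y with hR
    have hd : 0 ≤ dist x y := dist_nonneg
    have hR0 : 0 < R := by positivity
    have h := hdim y x r R hr (by linarith) (mem_ball.2 (by linarith))
    rw [hx, nonpos_iff_eq_zero, mul_eq_zero, ENNReal.ofReal_eq_zero] at h
    rcases h with h | h
    · exact absurd h (not_le.2 (by positivity))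
    · exact measure_mono_null (ball_subset_ball (by linarith)) h
  by_cases ht : ∃ (x : X) (r : ℝ), 0 < r ∧ μ (ball x r) = ⊤
  · obtain ⟨x, r, hr, hx⟩ := ht
    refine Or.inr (Or.inr fun y ρ hρ => ?_)
    set R := r + ρ + dist y x with hR
    have hd : 0 ≤ dist y x := dist_nonneg
    have hR0 : 0 < R := by positivity
    have h := hdim x y ρ R hρ (by linarith) (mem_ball.2 (by linarith))
    have hRtop : μ (ball x R) = ⊤ :=
      top_le_iff.1 (hx.symm.le.trans (measure_mono (ball_subset_ball (by linarith))))
    rw [hRtop, ENNReal.mul_top (by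
      rw [ne_eq, ENNReal.ofReal_eq_zero, not_le]; positivity)] at h
    exact top_le_iff.1 h
  · push Not at h0 ht
    exact Or.inl fun x r hr => ⟨h0 x r hr, ht x r hr⟩

theorem exists_gradient_dMax_of_ballsPosFinite [MetricSpace X] [MeasurableSpace X] [BorelSpace X]
    {μ : Measure X} {c Q s α p : ℝ} (hb : BallsPosFinite μ) (hQ : 0 < Q) (hc : 0 < c)
    (hdim : DimLowerBound μ c Q) (D : DiscreteMaxData X) (hs : 0 ≤ s) (hα : 0 ≤ α)
    (hsα1 : s + α ≤ 1) (hp : Q / (Q + s) < p) :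
    ∃ C : ℝ, 0 < C ∧ ∀ u g : X → ℝ, LocallyIntegrable u μ → IsHajlaszGradient μ s u g →
      eLpNorm g (ENNReal.ofReal p) μ ≠ ⊤ → (∃ x, D.dMax μ α u x ≠ ⊤) →
      ∃ G : X → ℝ, IsHajlaszGradient μ (s + α) (fun x => (D.dMax μ α u x).toReal) G ∧
        eLpNorm G (ENNReal.ofReal p) μ ≤ ENNReal.ofReal C * eLpNorm g (ENNReal.ofReal p) μ := by
  have := D.secondCountableTopology
  have hL := D.L_pos
  have hQs : 0 < Q + s := by linarith
  have hq0 : 0 < Q / (Q + s) := by positivity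
  have hp0 : 0 < p := hq0.trans hp
  set q := Q / (Q + s) with hq
  set t := p / q with ht
  have ht1 : 1 < t := (one_lt_div hq0).2 hp
  have hqinv : (Q + s) / Q * p = t := by
    rw [ht, hq]
    field_simp
  have hqt : q * t = p := by rw [ht]; field_simp
  obtain ⟨C₁, hC₁, hosc⟩ := exists_lintegral_abs_sub_le hb hc hQ hdim hs
  have hK5 : ∀ (x : X) (r : ℝ), 0 < r →
      μ (ball x (5 * r)) ≤ ENNReal.ofReal (c * (1 / 5) ^ Q)⁻¹ * μ (ball x r) :=
    fun x r hr => hdim.measure_ball_five_mul_le hc x hr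
  set H : ℝ≥0∞ := ENNReal.ofReal t * (2 * ENNReal.ofReal (c * (1 / 5) ^ Q)⁻¹) *
    (ENNReal.ofReal (t - 1))⁻¹ * ENNReal.ofReal (2 ^ (t - 1)) with hH
  have hHtop : H ≠ ⊤ := by
    have : (ENNReal.ofReal (t - 1))⁻¹ ≠ ⊤ := by simpa using ht1
    finiteness
  set K := 2 * D.N * D.L * (10 ^ s * (c * (3 / 10) ^ Q)⁻¹) +
        2 * (2 * (10 ^ s * (c * (3 / 10) ^ Q)⁻¹) + 1) with hK
  have hK0 : 0 < K := by positivity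
  set Λ : ℝ≥0∞ := ENNReal.ofReal ((K * (C₁ + 1) * 2) ^ p) * (1 + H) with hΛ
  have hΛtop : Λ ^ (1 / p) ≠ ⊤ := ENNReal.rpow_ne_top_of_nonneg (by positivity) (by finiteness)
  refine ⟨(Λ ^ (1 / p)).toReal + 1, by positivity, ?_⟩
  rintro u g hu ⟨hg, hg0, E, hE, hug⟩ hgp ⟨x₀, hx₀⟩
  have hum : AEMeasurable u μ := hu.aestronglyMeasurable.aemeasurable
  have hnorm : ∀ G : X → ℝ, (∀ x, 0 ≤ G x) → eLpNorm G (ENNReal.ofReal p) μ =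
      (∫⁻ x, ENNReal.ofReal (G x ^ p) ∂μ) ^ (1 / p) := by
    intro G hG
    rw [eLpNorm_eq_lintegral_rpow_enorm_toReal (by simpa using hp0) ENNReal.ofReal_ne_top,
      ENNReal.toReal_ofReal hp0.le]
    congr 1
    refine lintegral_congr fun x => ?_
    rw [Real.enorm_of_nonneg (hG x), ENNReal.ofReal_rpow_of_nonneg (hG x) hp0.le]
  set f : X → ℝ := fun y => g y ^ q with hf
  have hfm : Measurable f := by fun_prop
  have hf0 : ∀ y, 0 ≤ f y := fun y => Real.rpow_nonneg (hg0 y) q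
  have hft : ∀ y, f y ^ t = g y ^ p := fun y => by
    rw [hf, ← Real.rpow_mul (hg0 y), hqt]
  have hfin : ∫⁻ y, ENNReal.ofReal (f y ^ t) ∂μ ≠ ⊤ := by
    simp_rw [hft]
    rw [hnorm g hg0] at hgp
    intro htop
    rw [htop, ENNReal.top_rpow_of_pos (by positivity)] at hgp
    exact hgp rfl
  set M := uncenteredMax μ (fun y => ENNReal.ofReal (f y)) with hM
  have hMm : Measurable M := measurable_uncenteredMax _
  have hMtop : ∀ᵐ x ∂μ, M x < ⊤ :=
    ae_uncenteredMax_lt_top hb ENNReal.ofReal_ne_top hK5 ht1 hfm hfin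
  have hstrong : ∫⁻ x, M x ^ t ∂μ ≤ H * ∫⁻ y, ENNReal.ofReal (f y ^ t) ∂μ :=
    lintegral_uncenteredMax_rpow_le hb ENNReal.ofReal_ne_top hK5 ht1 hfm hf0 hfin
  set T : X → ℝ := fun x => (M x).toReal ^ ((Q + s) / Q) with hT
  have hT0 : ∀ x, 0 ≤ T x := fun x => by positivity
  have hTm : Measurable T := hMm.ennreal_toReal.pow_const _
  set A : X → ℝ := fun x => (C₁ + 1) * (g x + T x) with hA
  have hA0 : ∀ x, 0 ≤ A x := fun x => mul_nonneg (by positivity) (add_nonneg (hg0 x) (hT0 x))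
  have hbound : ∀ x ∉ E, M x ≠ ⊤ → OscillationBound μ s u (A x) x := by
    intro x hx hMx r hr
    refine (hosc u g E hg hg0 hE hug x hx hMx r hr).trans ?_
    refine mul_le_mul_left (ENNReal.ofReal_le_ofReal ?_) _
    have h1 : 0 ≤ r ^ s * (g x + T x) :=
      mul_nonneg (by positivity) (add_nonneg (hg0 x) (hT0 x))
    calc C₁ * r ^ s * (g x + T x) ≤ C₁ * r ^ s * (g x + T x) + r ^ s * (g x + T x) := by linarith
      _ = A x * r ^ s := by rw [hA]; ring
  refine ⟨fun x => K * A x, ⟨by fun_prop, fun x => mul_nonneg hK0.le (hA0 x),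
    E ∪ {x | ¬ M x < ⊤}, measure_union_null hE (ae_iff.1 hMtop), ?_⟩, ?_⟩
  · intro x hx y hy
    simp only [Set.mem_union, not_or] at hx hy
    obtain ⟨hxE, hxM⟩ := hx
    obtain ⟨hyE, hyM⟩ := hy
    have hxM' : M x ≠ ⊤ := (not_not.1 hxM).ne
    have hyM' : M y ≠ ⊤ := (not_not.1 hyM).ne
    have hxo := hbound x hxE hxM'
    have hyo := hbound y hyE hyM'
    rcases eq_or_ne x y with rfl | hne
    · rw [sub_self, abs_zero]
      have := hA0 x
      positivity
    have hd : 0 < dist x y := dist_pos.2 hne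
    have huxy : |u x - u y| ≤ dist x y ^ s * (A x + A y) := by
      refine (hug x hxE y hyE).trans ?_
      have hle : ∀ z, g z ≤ A z := fun z => by
        have h1 := hg0 z
        have h2 := hT0 z
        have h3 : 0 ≤ C₁ * (g z + T z) := by positivity
        simp only [hA]
        linarith
      gcongr ?_ * ?_
      exact add_le_add (hle x) (hle y)
    have hxF := hxo.dMax_ne_top D hb hc hdim hs hα hsα1 hum (hA0 x) hx₀
    have hyF := hyo.dMax_ne_top D hb hc hdim hs hα hsα1 hum (hA0 y) hx₀
    have h1 := hxo.dMax_le_add D hb hc hdim hs hα hsα1 hum (hA0 x) (hA0 y) hyo hd huxy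
    have h2 := hyo.dMax_le_add D hb hc hdim hs hα hsα1 hum (hA0 y) (hA0 x) hxo
      (by rwa [dist_comm]) (by rwa [abs_sub_comm, dist_comm, add_comm (A y)])
    rw [← hK] at h1 h2
    have hnn : ∀ a b : X, 0 ≤ K * dist a b ^ (s + α) * (A a + A b) := fun a b =>
      mul_nonneg (by positivity) (add_nonneg (hA0 a) (hA0 b))
    have hreal : ∀ a b : X, D.dMax μ α u b ≠ ⊤ → D.dMax μ α u a ≤ D.dMax μ α u b +
        ENNReal.ofReal (K * dist a b ^ (s + α) * (A a + A b)) →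
        (D.dMax μ α u a).toReal - (D.dMax μ α u b).toReal ≤
          K * dist a b ^ (s + α) * (A a + A b) := by
      intro a b hbF hab
      have h := ENNReal.toReal_mono (by finiteness) hab
      rw [ENNReal.toReal_add hbF ENNReal.ofReal_ne_top, ENNReal.toReal_ofReal (hnn a b)] at h
      linarith
    have e : dist x y ^ (s + α) * (K * A x + K * A y) =
        K * dist x y ^ (s + α) * (A x + A y) := by ring
    rw [e]
    refine abs_sub_le_iff.2 ⟨hreal x y hyF h1, (hreal y x hxF h2).trans_eq ?_⟩
    rw [dist_comm, add_comm (A y)]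
  · rw [hnorm _ fun x => mul_nonneg hK0.le (hA0 x), hnorm g hg0]
    have hpt : ∀ x, ENNReal.ofReal ((K * A x) ^ p) ≤
        ENNReal.ofReal ((K * (C₁ + 1) * 2) ^ p) * (ENNReal.ofReal (g x ^ p) + M x ^ t) := by
      intro x
      have hgx := hg0 x
      have hTx := hT0 x
      have hTp : ENNReal.ofReal (T x ^ p) ≤ M x ^ t := by
        simp only [hT]
        rw [← Real.rpow_mul ENNReal.toReal_nonneg, hqinv,
          ← ENNReal.ofReal_rpow_of_nonneg ENNReal.toReal_nonneg (by linarith)]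
        exact ENNReal.rpow_le_rpow ENNReal.ofReal_toReal_le (by linarith)
      have hmax : (K * A x) ^ p ≤ (K * (C₁ + 1) * 2) ^ p * (g x ^ p + T x ^ p) := by
        have h1 : K * A x ≤ K * (C₁ + 1) * 2 * max (g x) (T x) := by
          have h2 : g x + T x ≤ 2 * max (g x) (T x) := by
            linarith [le_max_left (g x) (T x), le_max_right (g x) (T x)]
          calc K * A x = K * (C₁ + 1) * (g x + T x) := by simp only [hA]; ring
            _ ≤ K * (C₁ + 1) * (2 * max (g x) (T x)) := by gcongr
            _ = _ := by ring
        have h3 : max (g x) (T x) ^ p ≤ g x ^ p + T x ^ p := by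
          have h4 : 0 ≤ g x ^ p := by positivity
          have h5 : 0 ≤ T x ^ p := by positivity
          rcases max_cases (g x) (T x) with ⟨h, -⟩ | ⟨h, -⟩ <;> rw [h] <;> linarith
        calc (K * A x) ^ p ≤ (K * (C₁ + 1) * 2 * max (g x) (T x)) ^ p :=
              Real.rpow_le_rpow (mul_nonneg hK0.le (hA0 x)) h1 hp0.le
          _ = (K * (C₁ + 1) * 2) ^ p * max (g x) (T x) ^ p :=
              Real.mul_rpow (by positivity) (le_max_of_le_left hgx)
          _ ≤ _ := by gcongr
      refine (ENNReal.ofReal_le_ofReal hmax).trans ?_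
      rw [ENNReal.ofReal_mul (by positivity), ENNReal.ofReal_add (by positivity) (by positivity)]
      gcongr
    have hgint : ∫⁻ x, ENNReal.ofReal ((K * A x) ^ p) ∂μ ≤
        Λ * ∫⁻ x, ENNReal.ofReal (g x ^ p) ∂μ := by
      refine (lintegral_mono hpt).trans ?_
      rw [lintegral_const_mul _ (by fun_prop), lintegral_add_left (by fun_prop), hΛ,
        mul_assoc (ENNReal.ofReal ((K * (C₁ + 1) * 2) ^ p))]
      refine mul_le_mul_right ?_ _
      rw [add_mul, one_mul]
      refine add_le_add le_rfl ?_
      simpa only [hft] using hstrong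
    calc (∫⁻ x, ENNReal.ofReal ((K * A x) ^ p) ∂μ) ^ (1 / p)
        ≤ (Λ * ∫⁻ x, ENNReal.ofReal (g x ^ p) ∂μ) ^ (1 / p) :=
          ENNReal.rpow_le_rpow hgint (by positivity)
      _ = Λ ^ (1 / p) * (∫⁻ x, ENNReal.ofReal (g x ^ p) ∂μ) ^ (1 / p) :=
          ENNReal.mul_rpow_of_nonneg _ _ (by positivity)
      _ ≤ _ := by
          gcongr
          rw [ENNReal.ofReal_add ENNReal.toReal_nonneg zero_le_one, ENNReal.ofReal_toReal hΛtop]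
          exact le_self_add

end Boundedness

theorem statement9 [MetricSpace X] [MeasurableSpace X] [BorelSpace X] (μ : Measure X)
    (c_d : ℝ≥0∞) (hdoub : IsDoubling μ c_d) (Q : ℝ) (hQ : 1 < Q)
    (c_Q : ℝ) (hcQ : 0 < c_Q) (hdim : DimLowerBound μ c_Q Q)
    (D : DiscreteMaxData X)
    (s α p : ℝ) (hs : 0 ≤ s) (hα : 0 ≤ α)
    (hsα0 : 0 < s + α) (hsα1 : s + α ≤ 1) (hp : Q / (Q + s) < p) :
    ∃ C : ℝ, 0 < C ∧ ∀ u : X → ℝ, LocallyIntegrable u μ →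
      hajlaszNorm μ s p u ≠ ⊤ → (∃ x, D.dMax μ α u x ≠ ⊤) →
      hajlaszNorm μ (s + α) p (fun x => (D.dMax μ α u x).toReal) ≤
        ENNReal.ofReal C * hajlaszNorm μ s p u := by
  rcases hdim.trichotomy hcQ with hb | h0 | htop
  · obtain ⟨C, hC, h⟩ := exists_gradient_dMax_of_ballsPosFinite hb (by linarith) hcQ hdim D hs hα
      hsα1 hp
    refine ⟨C, hC, fun u hu _ hfin => ?_⟩
    have hC0 : ENNReal.ofReal C ≠ 0 := by simpa using hC
    conv_rhs => rw [hajlaszNorm]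
    rw [← ENNReal.div_le_iff' hC0 ENNReal.ofReal_ne_top]
    refine le_iInf₂ fun g hg => ?_
    by_cases hgp : eLpNorm g (ENNReal.ofReal p) μ = ⊤
    · rw [hgp]
      exact le_top
    rw [ENNReal.div_le_iff' hC0 ENNReal.ofReal_ne_top]
    obtain ⟨G, hG, hGle⟩ := h u g hu hg hgp hfin
    exact (iInf₂_le G hG).trans hGle
  · refine ⟨1, one_pos, fun u _ _ _ => ?_⟩
    have hμ : μ = 0 := D.measure_eq_zero fun x => h0 x 1 one_pos
    refine (iInf₂_le (fun _ => (0 : ℝ)) ⟨measurable_const, fun _ => le_rfl, Set.univ, by simp [hμ],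
      fun x hx => absurd (Set.mem_univ x) hx⟩).trans ?_
    simp [hμ]
  · refine ⟨1, one_pos, fun u _ _ _ => ?_⟩
    have hzero : ∀ x, D.dMax μ α u x = 0 := fun x =>
      nonpos_iff_eq_zero.1 <| D.dMax_le fun r hr => by
        have hr' : (0 : ℝ) < r := by exact_mod_cast hr
        simp [DiscreteMaxData.discreteConv, setLAverage_eq, htop _ (3 * (r : ℝ)) (by positivity)]
    refine (iInf₂_le (fun _ => (0 : ℝ)) ⟨measurable_const, fun _ => le_rfl, ∅, measure_empty,
      fun x _ y _ => by simp [hzero]⟩).trans ?_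
    simp

end FracMaximal
end

section
/- Let s ∈ (0,∞), p ∈ (0, Q/s), and 0 < ε < ε' < s. There exists C > 0 such that for all measurable u with fractional s-Hajłasz gradient (g_j)_{j∈ℤ}, all x ∈ X and k ∈ ℤ: inf_{c∈ℝ} ( ⨍_{B(x,2^{-k})} |u - c|^{p*(ε)} dμ )^{1/p*(ε)} ≤ C 2^{-kε'} Σ_{j ≥ k-2} 2^{-j(s-ε')} ( ⨍_{B(x,2^{-k+1})} g_j^p dμ )^{1/p}, where p*(ε) = Qp/(Q - εp). -/
open MeasureTheory Metric ENNReal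

namespace FracMaximal

variable {X : Type*}

/-- Chebyshev: a function whose average over `2B` is at most `a` is small at some point of every
small ball centred in `B`, off a given null set. -/
lemma exists_mem_ball_le [MetricSpace X] [MeasurableSpace X] {μ : Measure X} {c Q : ℝ}
    (hdim : DimLowerBound μ c Q) {x y : X} {r R a t : ℝ} (hr : 0 < r) (hrR : r ≤ R)
    (hμ0 : μ (ball x (2 * R)) ≠ 0) (hμt : μ (ball x (2 * R)) ≠ ∞)
    {E : Set X} (hE : μ E = 0) {F : X → ℝ≥0∞} (hF : Measurable F)
    (hFa : ∫⁻ z in ball x (2 * R), F z ∂μ ≤ ENNReal.ofReal a * μ (ball x (2 * R)))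
    (hy : y ∈ ball x R) (ht : 0 < t) (ha : 0 < a) (hat : a < t * (c * (r / (2 * R)) ^ Q)) :
    ∃ z ∈ ball y r, z ∉ E ∧ F z ≤ ENNReal.ofReal t := by
  by_contra! hcon
  have hR : 0 < R := hr.trans_le hrR
  set S : Set X := {z | ENNReal.ofReal t ≤ F z}
  have hS : MeasurableSet S := measurableSet_le measurable_const hF
  have hsub : ball y r ⊆ E ∪ (S ∩ ball x (2 * R)) := by
    intro z hz
    by_cases hzE : z ∈ E
    · exact Or.inl hzE
    · refine Or.inr ⟨(hcon z hz hzE).le, ?_⟩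
      rw [mem_ball] at *
      linarith [dist_triangle z y x]
  have hle : μ (ball y r) ≤ μ.restrict (ball x (2 * R)) S := by
    rw [Measure.restrict_apply hS]
    calc μ (ball y r) ≤ μ (E ∪ (S ∩ ball x (2 * R))) := measure_mono hsub
      _ ≤ μ E + μ (S ∩ ball x (2 * R)) := measure_union_le _ _
      _ = _ := by rw [hE, zero_add]
  have hlow := hdim x y r (2 * R) hr (by linarith) (ball_subset_ball (by linarith) hy)
  have hmul : ENNReal.ofReal (t * (c * (r / (2 * R)) ^ Q)) * μ (ball x (2 * R))
      ≤ ENNReal.ofReal a * μ (ball x (2 * R)) := by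
    calc _ = ENNReal.ofReal t *
          (ENNReal.ofReal (c * (r / (2 * R)) ^ Q) * μ (ball x (2 * R))) := by
          rw [ENNReal.ofReal_mul ht.le, mul_assoc]
      _ ≤ ENNReal.ofReal t * μ.restrict (ball x (2 * R)) S := by gcongr; exact hlow.trans hle
      _ ≤ ∫⁻ z in ball x (2 * R), F z ∂μ := mul_meas_ge_le_lintegral hF _
      _ ≤ _ := hFa
  rw [ENNReal.mul_le_mul_iff_left hμ0 hμt, ENNReal.ofReal_le_ofReal_iff ha.le] at hmul
  linarith

/-- The oscillation bound, evaluated at the dyadic scale `n` and the dyadic level `m`. -/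
lemma two_mul_rpow_mul_rpow_le {d b R p ε Q a K : ℝ} (hR : 0 < R) (hε : 0 < ε)
    (ha : 0 < a) (hK : 0 < K) (hb : 0 < b) (hd0 : 0 ≤ d) {n m : ℝ}
    (hd : d ≤ b * (R * (2 : ℝ) ^ (-n))) :
    2 * d ^ ε * (K * a * (2 : ℝ) ^ (m * Q)) ^ (1 / p) ≤
      2 * b ^ ε * K ^ (1 / p) * (R ^ ε * a ^ (1 / p)) * (2 : ℝ) ^ (m * (Q / p) - n * ε) := by
  have h2 : (0 : ℝ) < 2 := two_pos
  have hd' : d ^ ε ≤ b ^ ε * (R ^ ε * (2 : ℝ) ^ (-n * ε)) := by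
    calc d ^ ε ≤ (b * (R * (2 : ℝ) ^ (-n))) ^ ε := Real.rpow_le_rpow hd0 hd hε.le
      _ = _ := by
        rw [Real.mul_rpow hb.le (by positivity), Real.mul_rpow hR.le (by positivity),
          ← Real.rpow_mul h2.le]
  have ht : (K * a * (2 : ℝ) ^ (m * Q)) ^ (1 / p)
      = K ^ (1 / p) * a ^ (1 / p) * (2 : ℝ) ^ (m * (Q / p)) := by
    rw [Real.mul_rpow (by positivity) (by positivity), Real.mul_rpow hK.le ha.le,
      ← Real.rpow_mul h2.le]
    congr 2
    ring
  rw [ht, show m * (Q / p) - n * ε = m * (Q / p) + -n * ε by ring, Real.rpow_add h2]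
  calc _ ≤ 2 * (b ^ ε * (R ^ ε * (2 : ℝ) ^ (-n * ε))) *
        (K ^ (1 / p) * a ^ (1 / p) * (2 : ℝ) ^ (m * (Q / p))) := by gcongr
    _ = _ := by ring

/-- Telescoping along points `z` approaching `x` dyadically: if `F x` is at most of size `2 ^ (nQ)`,
then `|u x - u w|` is at most of size `2 ^ (n(Q/p - ε))`. -/
lemma abs_sub_le_of_le_rpow [MetricSpace X] {E : Set X} {F : X → ℝ≥0∞} {u : X → ℝ}
    {x₀ x w : X} {R p ε Q a K M : ℝ} (hR : 0 < R) (hε : 0 < ε) (hQ : 0 < Q)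
    (ha : 0 < a) (hK : 0 < K)
    (hosc : ∀ y ∈ ball x₀ (2 * R), y ∉ E → ∀ z ∈ ball x₀ (2 * R), z ∉ E → ∀ t : ℝ, 0 < t →
      F y ≤ ENNReal.ofReal t → F z ≤ ENNReal.ofReal t →
        |u y - u z| ≤ 2 * dist y z ^ ε * t ^ (1 / p))
    (hw : w ∈ ball x₀ R) (hwE : w ∉ E) (hwF : F w ≤ ENNReal.ofReal (K * a))
    (hx : x ∈ ball x₀ R) (hxE : x ∉ E)
    (hgood : ∀ n : ℕ, ∃ z ∈ ball x (R * (2 : ℝ) ^ (-(n : ℝ))), z ∉ E ∧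
      F z ≤ ENNReal.ofReal (K * a * (2 : ℝ) ^ (n * Q)))
    (hM0 : 2 * (4 : ℝ) ^ ε * K ^ (1 / p) ≤ M)
    (hM : M + 2 * (2 : ℝ) ^ ε * K ^ (1 / p) * (2 : ℝ) ^ (Q / p) ≤ M * (2 : ℝ) ^ (Q / p - ε))
    (n : ℕ) (hxF : F x ≤ ENNReal.ofReal (K * a * (2 : ℝ) ^ (n * Q))) :
    |u x - u w| ≤
      (M + 2 * K ^ (1 / p)) * (R ^ ε * a ^ (1 / p)) * (2 : ℝ) ^ (n * (Q / p - ε)) := by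
  have h2 : (0 : ℝ) < 2 := two_pos
  have hle1 : ∀ n : ℕ, R * (2 : ℝ) ^ (-(n : ℝ)) ≤ R := fun n ↦
    mul_le_of_le_one_right hR.le
      (Real.rpow_le_one_of_one_le_of_nonpos one_le_two (by simp))
  have hmem : ∀ n : ℕ, ∀ z ∈ ball x (R * (2 : ℝ) ^ (-(n : ℝ))), z ∈ ball x₀ (2 * R) := by
    intro n z hz
    rw [mem_ball] at *
    linarith [dist_triangle z x x₀, hle1 n]
  have hB : ball x₀ R ⊆ ball x₀ (2 * R) := ball_subset_ball (by linarith)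
  set L : ℝ := R ^ ε * a ^ (1 / p)
  have hL : 0 < L := by positivity
  have hchain : ∀ n : ℕ, ∃ z ∈ ball x (R * (2 : ℝ) ^ (-(n : ℝ))), z ∉ E ∧
      F z ≤ ENNReal.ofReal (K * a * (2 : ℝ) ^ (n * Q)) ∧
      |u z - u w| ≤ M * L * (2 : ℝ) ^ (n * (Q / p - ε)) := by
    intro n
    induction n with
    | zero =>
      obtain ⟨z, hz, hzE, hzF⟩ := hgood 0
      refine ⟨z, hz, hzE, hzF, ?_⟩
      have hd : dist z w ≤ 4 * (R * (2 : ℝ) ^ (-(0 : ℝ))) := by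
        have hz' := hmem 0 z hz
        rw [mem_ball] at hz' hw
        simp only [neg_zero, Real.rpow_zero, mul_one]
        linarith [dist_triangle_right z w x₀]
      have h1 := hosc z (hmem 0 z hz) hzE w (hB hw) hwE (K * a * (2 : ℝ) ^ ((0 : ℝ) * Q))
        (by positivity) (by simpa using hzF) (by simpa using hwF)
      have h3 := two_mul_rpow_mul_rpow_le (p := p) (Q := Q) (m := 0) hR hε ha hK
        (by norm_num) dist_nonneg hd
      simp only [zero_mul, sub_zero, Real.rpow_zero, mul_one, Nat.cast_zero] at h1 h3 ⊢
      exact h1.trans (h3.trans (by gcongr))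
    | succ n ih =>
      obtain ⟨y, hy, hyE, hyF, hyu⟩ := ih
      obtain ⟨z, hz, hzE, hzF⟩ := hgood (n + 1)
      refine ⟨z, hz, hzE, hzF, ?_⟩
      have hd : dist z y ≤ 2 * (R * (2 : ℝ) ^ (-(n : ℝ))) := by
        have hmono : R * (2 : ℝ) ^ (-((n + 1 : ℕ) : ℝ)) ≤ R * (2 : ℝ) ^ (-(n : ℝ)) := by
          gcongr
          · exact one_le_two
          · simp
        rw [mem_ball] at hz hy
        linarith [dist_triangle_right z y x]
      have hyF' : F y ≤ ENNReal.ofReal (K * a * (2 : ℝ) ^ (((n + 1 : ℕ) : ℝ) * Q)) := by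
        refine hyF.trans (ENNReal.ofReal_le_ofReal ?_)
        gcongr
        · exact one_le_two
        · simp
      have h1 := hosc z (hmem _ z hz) hzE y (hmem _ y hy) hyE _ (by positivity) hzF hyF'
      have h3 := two_mul_rpow_mul_rpow_le (p := p) (Q := Q) (m := ((n + 1 : ℕ) : ℝ)) hR hε ha hK
        h2 dist_nonneg hd
      have hexp : (2 : ℝ) ^ (((n + 1 : ℕ) : ℝ) * (Q / p) - n * ε)
          = (2 : ℝ) ^ (Q / p) * (2 : ℝ) ^ (n * (Q / p - ε)) := by
        rw [← Real.rpow_add h2]; push_cast; ring_nf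
      have hexp' : (2 : ℝ) ^ (((n + 1 : ℕ) : ℝ) * (Q / p - ε))
          = (2 : ℝ) ^ (Q / p - ε) * (2 : ℝ) ^ (n * (Q / p - ε)) := by
        rw [← Real.rpow_add h2]; push_cast; ring_nf
      rw [hexp] at h3
      rw [hexp']
      calc |u z - u w| ≤ |u z - u y| + |u y - u w| := abs_sub_le _ _ _
        _ ≤ _ := add_le_add (h1.trans h3) hyu
        _ = (M + 2 * (2 : ℝ) ^ ε * K ^ (1 / p) * (2 : ℝ) ^ (Q / p)) *
            (L * (2 : ℝ) ^ (n * (Q / p - ε))) := by ring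
        _ ≤ (M * (2 : ℝ) ^ (Q / p - ε)) * (L * (2 : ℝ) ^ (n * (Q / p - ε))) := by gcongr
        _ = _ := by ring
  obtain ⟨z, hz, hzE, hzF, hzu⟩ := hchain n
  have hd : dist x z ≤ 1 * (R * (2 : ℝ) ^ (-(n : ℝ))) := by
    rw [one_mul, dist_comm]; exact (mem_ball.1 hz).le
  have h1 := hosc x (hB hx) hxE z (hmem _ z hz) hzE _ (by positivity) hxF hzF
  have h3 := two_mul_rpow_mul_rpow_le (p := p) (Q := Q) (m := n) hR hε ha hK
    one_pos dist_nonneg hd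
  rw [Real.one_rpow, ← mul_sub] at h3
  calc |u x - u w| ≤ |u x - u z| + |u z - u w| := abs_sub_le _ _ _
    _ ≤ _ := add_le_add (h1.trans h3) hzu
    _ = _ := by ring

/-- Pointwise Sobolev-type bound obtained by optimizing the scale `n` in
`abs_sub_le_of_le_rpow`. -/
lemma ofReal_rpow_le_of_forall_nat {v M L δ Q q a K : ℝ} {f : ℝ≥0∞} (hM : 0 < M) (hL : 0 < L)
    (hQ : 0 < Q) (hq : 0 < q) (hqδ : δ * q = Q) (ha : 0 < a) (hK : 1 ≤ K)
    (h : ∀ n : ℕ, f ≤ ENNReal.ofReal (K * a * (2 : ℝ) ^ (n * Q)) →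
      |v| ≤ M * L * (2 : ℝ) ^ (n * δ)) :
    ENNReal.ofReal (|v| ^ q) ≤
      ENNReal.ofReal ((M * L) ^ q) * (1 + ENNReal.ofReal ((2 : ℝ) ^ Q / a) * f) := by
  have h2 : (0 : ℝ) < 2 := two_pos
  have hc : 0 < (M * L) ^ q := by positivity
  rcases eq_or_ne f ∞ with rfl | hf
  · rw [ENNReal.mul_top (ENNReal.ofReal_pos.2 (by positivity)).ne', add_top,
      ENNReal.mul_top (ENNReal.ofReal_pos.2 hc).ne']
    exact le_top
  have hv : ∀ n : ℕ, f ≤ ENNReal.ofReal (K * a * (2 : ℝ) ^ (n * Q)) →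
      ENNReal.ofReal (|v| ^ q) ≤
        ENNReal.ofReal ((M * L) ^ q) * ENNReal.ofReal ((2 : ℝ) ^ (n * Q)) := by
    intro n hn
    rw [← ENNReal.ofReal_mul hc.le]
    refine ENNReal.ofReal_le_ofReal ?_
    calc |v| ^ q ≤ (M * L * (2 : ℝ) ^ (n * δ)) ^ q :=
          Real.rpow_le_rpow (abs_nonneg _) (h n hn) hq.le
      _ = _ := by
        rw [Real.mul_rpow (by positivity) (by positivity), ← Real.rpow_mul h2.le, mul_assoc, hqδ]
  have hex : ∃ n : ℕ, f ≤ ENNReal.ofReal (K * a * (2 : ℝ) ^ (n * Q)) := by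
    obtain ⟨n, hn⟩ := pow_unbounded_of_one_lt (f.toReal / (K * a))
      (Real.one_lt_rpow one_lt_two hQ)
    refine ⟨n, (ENNReal.le_ofReal_iff_toReal_le hf (by positivity)).2 ?_⟩
    rw [div_lt_iff₀ (by positivity), ← Real.rpow_natCast, ← Real.rpow_mul h2.le] at hn
    rw [mul_comm (n : ℝ)]
    linarith
  classical
  refine (hv _ (Nat.find_spec hex)).trans ?_
  gcongr
  rcases hn : Nat.find hex with _ | n
  · simp
  · have hlt := Nat.find_min hex (m := n) (by omega)
    rw [not_le] at hlt
    refine le_trans ?_ le_add_self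
    calc ENNReal.ofReal ((2 : ℝ) ^ (((n + 1 : ℕ) : ℝ) * Q))
        ≤ ENNReal.ofReal ((2 : ℝ) ^ Q / a * (K * a * (2 : ℝ) ^ (n * Q))) := by
          refine ENNReal.ofReal_le_ofReal ?_
          have : (2 : ℝ) ^ (((n + 1 : ℕ) : ℝ) * Q) = (2 : ℝ) ^ Q * (2 : ℝ) ^ (n * Q) := by
            rw [← Real.rpow_add h2]; push_cast; ring_nf
          rw [this]
          calc (2 : ℝ) ^ Q * (2 : ℝ) ^ (n * Q) ≤ K * ((2 : ℝ) ^ Q * (2 : ℝ) ^ (n * Q)) :=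
                le_mul_of_one_le_left (by positivity) hK
            _ = _ := by field_simp
      _ = ENNReal.ofReal ((2 : ℝ) ^ Q / a) * ENNReal.ofReal (K * a * (2 : ℝ) ^ (n * Q)) :=
          ENNReal.ofReal_mul (by positivity)
      _ ≤ _ := by gcongr

/-- Sobolev--Poincaré inequality for functions with a first-order-type oscillation control
`|u y - u z| ≤ d(y,z)^ε (F y ^ (1/p) + F z ^ (1/p))`, with `F` a power of the gradient. -/
lemma exists_sobolev_poincare [MetricSpace X] [MeasurableSpace X] {μ : Measure X}
    {c Q p ε : ℝ} (hQ : 0 < Q) (hc : 0 < c) (hdim : DimLowerBound μ c Q) (hp : 0 < p)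
    (hε : 0 < ε) (hεp : ε * p < Q) :
    ∃ C : ℝ, 0 < C ∧ ∀ (u : X → ℝ) (F : X → ℝ≥0∞) (E : Set X) (x : X) (R a : ℝ),
      Measurable u → Measurable F → μ E = 0 → 0 < R → 0 < a →
      (∀ y ∈ ball x (2 * R), y ∉ E → ∀ z ∈ ball x (2 * R), z ∉ E → ∀ t : ℝ, 0 < t →
        F y ≤ ENNReal.ofReal t → F z ≤ ENNReal.ofReal t →
          |u y - u z| ≤ 2 * dist y z ^ ε * t ^ (1 / p)) →
      ⨍⁻ y in ball x (2 * R), F y ∂μ ≤ ENNReal.ofReal a →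
      ⨅ b : ℝ, (⨍⁻ y in ball x R,
          ENNReal.ofReal (|u y - b| ^ (Q * p / (Q - ε * p))) ∂μ) ^ ((Q - ε * p) / (Q * p)) ≤
        ENNReal.ofReal (C * (R ^ ε * a ^ (1 / p))) := by
  have h2 : (0 : ℝ) < 2 := two_pos
  have hden : 0 < Q - ε * p := by linarith
  set q : ℝ := Q * p / (Q - ε * p) with hqdef
  have hq : 0 < q := by positivity
  have hqinv : (Q - ε * p) / (Q * p) = 1 / q := by rw [hqdef, one_div_div]
  have hδ : 0 < Q / p - ε := by rw [sub_pos, lt_div_iff₀ hp]; exact hεp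
  have hqδ : (Q / p - ε) * q = Q := by
    have hden' := hden.ne'
    rw [hqdef, show Q / p - ε = (Q - ε * p) / p by field_simp]
    field_simp
  set K : ℝ := max 1 (2 * 2 ^ Q / c)
  have hK1 : 1 ≤ K := le_max_left _ _
  have hK0 : 0 < K := one_pos.trans_le hK1
  have hKc : 2 * (2 : ℝ) ^ Q / c ≤ K := le_max_right _ _
  have h2δ : 0 < (2 : ℝ) ^ (Q / p - ε) - 1 := sub_pos.2 (Real.one_lt_rpow one_lt_two hδ)
  set D : ℝ := 2 * (2 : ℝ) ^ ε * K ^ (1 / p) * (2 : ℝ) ^ (Q / p)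
  have hD : 0 < D := by positivity
  set M : ℝ := max (2 * (4 : ℝ) ^ ε * K ^ (1 / p)) (D / ((2 : ℝ) ^ (Q / p - ε) - 1))
  have hM0 : 2 * (4 : ℝ) ^ ε * K ^ (1 / p) ≤ M := le_max_left _ _
  have hMpos : 0 < M := lt_of_lt_of_le (by positivity) hM0
  have hM : M + D ≤ M * (2 : ℝ) ^ (Q / p - ε) := by
    have : D / ((2 : ℝ) ^ (Q / p - ε) - 1) ≤ M := le_max_right _ _
    rw [div_le_iff₀ h2δ] at this
    linarith
  set M' : ℝ := M + 2 * K ^ (1 / p)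
  have hM' : 0 < M' := by positivity
  set T : ℝ := 1 + 2 ^ Q * (2 ^ Q / c)
  have hT : 0 < T := by positivity
  refine ⟨M' * T ^ (1 / q), by positivity, ?_⟩
  intro u F E x R a hu hF hE hR ha hosc hFa
  set L : ℝ := R ^ ε * a ^ (1 / p)
  have hL : 0 < L := by positivity
  rw [hqinv]
  have hq1 : 0 < 1 / q := by positivity
  by_cases hB : μ (ball x R) = 0 ∨ μ (ball x R) = ∞
  · refine (iInf_le _ 0).trans (le_of_eq_of_le ?_ zero_le)
    rw [setLAverage_eq]
    rcases hB with hB | hB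
    · rw [Measure.restrict_eq_zero.2 hB, lintegral_zero_measure, ENNReal.zero_div,
        ENNReal.zero_rpow_of_pos hq1]
    · rw [hB, ENNReal.div_top, ENNReal.zero_rpow_of_pos hq1]
  push Not at hB
  obtain ⟨hB0, hBt⟩ := hB
  have hdoub : μ (ball x (2 * R)) ≤ ENNReal.ofReal (2 ^ Q / c) * μ (ball x R) := by
    have h := hdim x x R (2 * R) hR (by linarith) (mem_ball_self (by linarith))
    have he : c * (R / (2 * R)) ^ Q = (2 ^ Q / c)⁻¹ := by
      rw [show R / (2 * R) = 2⁻¹ by field_simp, Real.inv_rpow h2.le, inv_div]; rfl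
    rwa [he, ENNReal.ofReal_inv_of_pos (by positivity),
      ENNReal.inv_mul_le_iff (ENNReal.ofReal_pos.2 (by positivity)).ne' ENNReal.ofReal_ne_top] at h
  have h2B0 : μ (ball x (2 * R)) ≠ 0 := fun h ↦
    hB0 (measure_mono_null (ball_subset_ball (by linarith)) h)
  have h2Bt : μ (ball x (2 * R)) ≠ ∞ :=
    ne_top_of_le_ne_top (ENNReal.mul_ne_top ENNReal.ofReal_ne_top hBt) hdoub
  have hFint : ∫⁻ z in ball x (2 * R), F z ∂μ ≤ ENNReal.ofReal a * μ (ball x (2 * R)) := by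
    rwa [setLAverage_eq, ENNReal.div_le_iff h2B0 h2Bt] at hFa
  have hgood : ∀ y ∈ ball x R, ∀ n : ℕ, ∃ z ∈ ball y (R * (2 : ℝ) ^ (-(n : ℝ))), z ∉ E ∧
      F z ≤ ENNReal.ofReal (K * a * (2 : ℝ) ^ (n * Q)) := by
    intro y hy n
    refine exists_mem_ball_le hdim (by positivity) ?_ h2B0 h2Bt hE hF hFint hy (by positivity) ha ?_
    · exact mul_le_of_le_one_right hR.le
        (Real.rpow_le_one_of_one_le_of_nonpos one_le_two (by simp))
    · have he : (R * (2 : ℝ) ^ (-(n : ℝ)) / (2 * R)) ^ Q = ((2 : ℝ) ^ (n * Q) * 2 ^ Q)⁻¹ := by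
        rw [show R * (2 : ℝ) ^ (-(n : ℝ)) / (2 * R) = ((2 : ℝ) ^ (n : ℝ) * 2)⁻¹ by
          rw [Real.rpow_neg h2.le]; field_simp, Real.inv_rpow (by positivity),
          Real.mul_rpow (by positivity) h2.le, ← Real.rpow_mul h2.le]
      rw [he]
      calc a < 2 * a := by linarith
        _ = 2 * 2 ^ Q / c * a * 2 ^ (n * Q) * (c * ((2 : ℝ) ^ (n * Q) * 2 ^ Q)⁻¹) := by
          field_simp
        _ ≤ _ := by gcongr
  obtain ⟨w, hw, hwE, hwF⟩ := hgood x (mem_ball_self hR) 0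
  simp only [Nat.cast_zero, neg_zero, Real.rpow_zero, mul_one, zero_mul] at hw hwF
  refine (iInf_le _ (u w)).trans ?_
  have hpt : ∀ᵐ y ∂μ.restrict (ball x R), ENNReal.ofReal (|u y - u w| ^ q) ≤
      ENNReal.ofReal ((M' * L) ^ q) * (1 + ENNReal.ofReal ((2 : ℝ) ^ Q / a) * F y) := by
    rw [ae_restrict_iff (measurableSet_le (by fun_prop) (by fun_prop))]
    have hE' : ∀ᵐ y ∂μ, y ∉ E := measure_eq_zero_iff_ae_notMem.1 hE
    filter_upwards [hE'] with y hyE hy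
    exact ofReal_rpow_le_of_forall_nat hM' hL hQ hq hqδ ha hK1 fun n hn ↦
      abs_sub_le_of_le_rpow hR hε hQ ha hK0 hosc hw hwE hwF hy hyE (hgood y hy) hM0 hM n hn
  have hFB : ∫⁻ y in ball x R, F y ∂μ ≤
      ENNReal.ofReal a * (ENNReal.ofReal (2 ^ Q / c) * μ (ball x R)) :=
    (lintegral_mono_set (ball_subset_ball (by linarith))).trans (hFint.trans (by gcongr))
  have hint : ∫⁻ y in ball x R, ENNReal.ofReal (|u y - u w| ^ q) ∂μ ≤
      ENNReal.ofReal ((M' * L) ^ q * T) * μ (ball x R) := by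
    calc _ ≤ ∫⁻ y in ball x R, ENNReal.ofReal ((M' * L) ^ q) *
          (1 + ENNReal.ofReal ((2 : ℝ) ^ Q / a) * F y) ∂μ := lintegral_mono_ae hpt
      _ = ENNReal.ofReal ((M' * L) ^ q) * (μ (ball x R) +
          ENNReal.ofReal ((2 : ℝ) ^ Q / a) * ∫⁻ y in ball x R, F y ∂μ) := by
        rw [lintegral_const_mul _ (by fun_prop), lintegral_add_left measurable_const,
          lintegral_const_mul _ hF]
        simp
      _ ≤ ENNReal.ofReal ((M' * L) ^ q) * (μ (ball x R) + ENNReal.ofReal ((2 : ℝ) ^ Q / a) *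
          (ENNReal.ofReal a * (ENNReal.ofReal (2 ^ Q / c) * μ (ball x R)))) := by gcongr
      _ = ENNReal.ofReal ((M' * L) ^ q) * ((1 + ENNReal.ofReal ((2 : ℝ) ^ Q / a) *
          ENNReal.ofReal a * ENNReal.ofReal (2 ^ Q / c)) * μ (ball x R)) := by ring
      _ = _ := by
        rw [← ENNReal.ofReal_mul (by positivity), ← ENNReal.ofReal_mul (by positivity),
          ← ENNReal.ofReal_one, ← ENNReal.ofReal_add zero_le_one (by positivity), ← mul_assoc,
          ← ENNReal.ofReal_mul (by positivity), div_mul_cancel₀ _ ha.ne']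
  calc _ ≤ ENNReal.ofReal ((M' * L) ^ q * T) ^ (1 / q) := by
        gcongr
        rwa [setLAverage_eq, ENNReal.div_le_iff hB0 hBt]
    _ = ENNReal.ofReal (M' * T ^ (1 / q) * L) := by
        rw [ENNReal.ofReal_rpow_of_pos (by positivity),
          Real.mul_rpow (by positivity) hT.le, ← Real.rpow_mul (by positivity),
          mul_one_div_cancel hq.ne', Real.rpow_one]
        ring_nf

/-- The geometric series `∑_{j ≥ k - 2} 2 ^ (-jθ)` is comparable to `2 ^ (-kθ)`. -/
lemma tsum_ofReal_two_rpow_le {θ : ℝ} (hθ : 0 < θ) (k : ℤ) :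
    ∑' j : {j : ℤ // k - 2 ≤ j}, ENNReal.ofReal ((2 : ℝ) ^ (-(j.1 : ℝ) * θ)) ≤
      ENNReal.ofReal ((2 : ℝ) ^ (2 * θ) * (1 - (2 : ℝ) ^ (-θ))⁻¹ * (2 : ℝ) ^ (-(k : ℝ) * θ)) := by
  have h2 : (0 : ℝ) < 2 := two_pos
  have hlt : (2 : ℝ) ^ (-θ) < 1 := Real.rpow_lt_one_of_one_lt_of_neg one_lt_two (by linarith)
  have hnn : (0 : ℝ) ≤ (2 : ℝ) ^ (-θ) := by positivity
  set f : ℕ → ℝ := fun n ↦ (2 : ℝ) ^ (-(k : ℝ) * θ) * (2 : ℝ) ^ (2 * θ) * ((2 : ℝ) ^ (-θ)) ^ n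
  have hf : Summable f := (summable_geometric_of_lt_one hnn hlt).mul_left _
  set φ : {j : ℤ // k - 2 ≤ j} → ℕ := fun j ↦ (j.1 - (k - 2)).toNat
  have hφc : ∀ j, ((φ j : ℕ) : ℤ) = j.1 - (k - 2) := fun j ↦
    Int.toNat_of_nonneg (by linarith [j.2])
  have hφ : Function.Injective φ := by
    intro i j hij
    have := hφc i
    rw [hij, hφc j] at this
    exact Subtype.ext (by linarith)
  have hterm : ∀ j : {j : ℤ // k - 2 ≤ j}, (2 : ℝ) ^ (-(j.1 : ℝ) * θ) = f (φ j) := by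
    intro j
    have hc : ((φ j : ℕ) : ℝ) = (j.1 : ℝ) - (k - 2) := by exact_mod_cast hφc j
    simp only [f]
    rw [← Real.rpow_natCast, ← Real.rpow_mul h2.le, ← Real.rpow_add h2, ← Real.rpow_add h2, hc]
    ring_nf
  calc _ = ∑' j, ENNReal.ofReal (f (φ j)) := by simp_rw [hterm]
    _ ≤ ∑' n, ENNReal.ofReal (f n) :=
      ENNReal.tsum_comp_le_tsum_of_injective hφ fun n ↦ ENNReal.ofReal (f n)
    _ = ENNReal.ofReal (∑' n, f n) :=
      (ENNReal.ofReal_tsum_of_nonneg (fun n ↦ by positivity) hf).symm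
    _ = _ := by
      rw [tsum_mul_left, tsum_geometric_of_lt_one hnn hlt]
      ring_nf

/-- The `ℓ^p`-type aggregate `∑_{j ≥ k - 2} 2 ^ (-jσp) g_j ^ p` of the gradients controlling the
oscillation at scales below `2 ^ (2 - k)`. -/
noncomputable def gradSum (g : ℤ → X → ℝ) (σ p : ℝ) (k : ℤ) (y : X) : ℝ≥0∞ :=
  ∑' j : {j : ℤ // k - 2 ≤ j},
    ENNReal.ofReal ((2 : ℝ) ^ (-(j.1 : ℝ) * σ * p)) * ENNReal.ofReal (g j.1 y ^ p)

lemma mul_le_rpow_of_gradSum_le {g : ℤ → X → ℝ} {σ p : ℝ} {k : ℤ} {y : X} {t : ℝ}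
    (hg : ∀ k x, 0 ≤ g k x) (hp : 0 < p) (ht : 0 < t)
    (h : gradSum g σ p k y ≤ ENNReal.ofReal t) {j : ℤ} (hj : k - 2 ≤ j) :
    (2 : ℝ) ^ (-(j : ℝ) * σ) * g j y ≤ t ^ (1 / p) := by
  have h1 : ENNReal.ofReal ((2 : ℝ) ^ (-(j : ℝ) * σ * p)) * ENNReal.ofReal (g j y ^ p)
      ≤ ENNReal.ofReal t :=
    (ENNReal.le_tsum (f := fun j : {j : ℤ // k - 2 ≤ j} ↦
      ENNReal.ofReal ((2 : ℝ) ^ (-(j.1 : ℝ) * σ * p)) * ENNReal.ofReal (g j.1 y ^ p))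
      ⟨j, hj⟩).trans h
  have hgj := hg j y
  rw [← ENNReal.ofReal_mul (by positivity), ENNReal.ofReal_le_ofReal_iff ht.le,
    Real.rpow_mul two_pos.le, ← Real.mul_rpow (by positivity) hgj] at h1
  rw [one_div]
  exact (Real.le_rpow_inv_iff_of_pos (by positivity) ht.le hp).2 h1

lemma abs_sub_le_of_gradSum_le [MetricSpace X] {g : ℤ → X → ℝ} {u : X → ℝ} {s ε p : ℝ} {k : ℤ}
    {E : Set X} (hg : ∀ k x, 0 ≤ g k x)
    (hu : ∀ (k : ℤ), ∀ x ∉ E, ∀ y ∉ E,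
      (2 : ℝ) ^ (-k - 1) ≤ dist x y → dist x y < (2 : ℝ) ^ (-k) →
        |u x - u y| ≤ dist x y ^ s * (g k x + g k y))
    (hp : 0 < p) (hεs : ε < s) {y z : X} (hy : y ∉ E) (hz : z ∉ E)
    (hd : dist y z < (2 : ℝ) ^ (-k + 2)) {t : ℝ} (ht : 0 < t)
    (hyt : gradSum g (s - ε) p k y ≤ ENNReal.ofReal t)
    (hzt : gradSum g (s - ε) p k z ≤ ENNReal.ofReal t) :
    |u y - u z| ≤ 2 * dist y z ^ ε * t ^ (1 / p) := by
  rcases eq_or_ne y z with rfl | hne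
  · rw [sub_self, abs_zero]
    positivity
  have hpos : 0 < dist y z := dist_pos.2 hne
  obtain ⟨n, hn1, hn2⟩ := exists_mem_Ico_zpow hpos one_lt_two
  obtain ⟨j, rfl⟩ : ∃ j : ℤ, n = -j - 1 := ⟨-n - 1, by ring⟩
  rw [sub_add_cancel] at hn2
  have hj : k - 2 ≤ j := by
    have := (zpow_lt_zpow_iff_right₀ (one_lt_two (α := ℝ))).1 (hn1.trans_lt hd)
    omega
  have hpow : dist y z ^ (s - ε) ≤ (2 : ℝ) ^ (-(j : ℝ) * (s - ε)) := by
    rw [Real.rpow_mul two_pos.le]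
    refine Real.rpow_le_rpow hpos.le ?_ (by linarith)
    rw [← Int.cast_neg, Real.rpow_intCast]
    exact hn2.le
  have hgy := hg j y
  have hgz := hg j z
  calc |u y - u z| ≤ dist y z ^ s * (g j y + g j z) := hu j y hy z hz hn1 hn2
    _ = dist y z ^ ε * (dist y z ^ (s - ε) * (g j y + g j z)) := by
      rw [← mul_assoc, ← Real.rpow_add hpos, add_sub_cancel]
    _ ≤ dist y z ^ ε * ((2 : ℝ) ^ (-(j : ℝ) * (s - ε)) * (g j y + g j z)) := by gcongr
    _ ≤ dist y z ^ ε * (t ^ (1 / p) + t ^ (1 / p)) := by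
      rw [mul_add]
      gcongr
      · exact mul_le_rpow_of_gradSum_le hg hp ht hyt hj
      · exact mul_le_rpow_of_gradSum_le hg hp ht hzt hj
    _ = _ := by ring

/-- The average of `gradSum` at order `s - ε` is controlled by the weighted sum of `L^p` averages
at the smaller order `s - ε'`. -/
lemma laverage_gradSum_le [MeasurableSpace X] {ν : Measure X} {g : ℤ → X → ℝ}
    {s ε ε' p : ℝ} {k : ℤ} (hgm : ∀ k, Measurable (g k)) (hp : 0 < p) (hεε' : ε < ε') {b : ℝ}
    (hb : 0 < b)
    (hS : ∑' j : {j : ℤ // k - 2 ≤ j}, ENNReal.ofReal ((2 : ℝ) ^ (-(j.1 : ℝ) * (s - ε'))) *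
      (⨍⁻ y, ENNReal.ofReal (g j.1 y ^ p) ∂ν) ^ (1 / p) ≤ ENNReal.ofReal b) :
    ⨍⁻ y, gradSum g (s - ε) p k y ∂ν ≤ ENNReal.ofReal (b ^ p *
      ((2 : ℝ) ^ (2 * ((ε' - ε) * p)) * (1 - (2 : ℝ) ^ (-((ε' - ε) * p)))⁻¹ *
        (2 : ℝ) ^ (-(k : ℝ) * ((ε' - ε) * p)))) := by
  have h2 : (0 : ℝ) < 2 := two_pos
  have hθ : 0 < (ε' - ε) * p := mul_pos (by linarith) hp
  have hterm : ∀ j : {j : ℤ // k - 2 ≤ j}, ENNReal.ofReal ((2 : ℝ) ^ (-(j.1 : ℝ) * (s - ε) * p)) *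
      ⨍⁻ y, ENNReal.ofReal (g j.1 y ^ p) ∂ν ≤
      ENNReal.ofReal (b ^ p) * ENNReal.ofReal ((2 : ℝ) ^ (-(j.1 : ℝ) * ((ε' - ε) * p))) := by
    intro j
    have hj := ENNReal.rpow_le_rpow ((ENNReal.le_tsum j).trans hS) hp.le
    rw [ENNReal.mul_rpow_of_nonneg _ _ hp.le, ← ENNReal.rpow_mul, one_div_mul_cancel hp.ne',
      ENNReal.rpow_one, ENNReal.ofReal_rpow_of_pos (by positivity),
      ENNReal.ofReal_rpow_of_pos hb, ← Real.rpow_mul h2.le] at hj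
    calc _ = ENNReal.ofReal ((2 : ℝ) ^ (-(j.1 : ℝ) * (s - ε') * p)) *
          (⨍⁻ y, ENNReal.ofReal (g j.1 y ^ p) ∂ν) *
          ENNReal.ofReal ((2 : ℝ) ^ (-(j.1 : ℝ) * ((ε' - ε) * p))) := by
          have hexp : -(j.1 : ℝ) * (s - ε) * p =
              -(j.1 : ℝ) * (s - ε') * p + -(j.1 : ℝ) * ((ε' - ε) * p) := by ring
          rw [hexp, Real.rpow_add h2, ENNReal.ofReal_mul (by positivity), mul_right_comm]
      _ ≤ _ := mul_le_mul' hj le_rfl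
  have hm : ∀ j : ℤ, Measurable fun y ↦ ENNReal.ofReal (g j y ^ p) := fun j ↦
    ((hgm j).pow_const p).ennreal_ofReal
  have hsplit : ⨍⁻ y, gradSum g (s - ε) p k y ∂ν = ∑' j : {j : ℤ // k - 2 ≤ j},
      ENNReal.ofReal ((2 : ℝ) ^ (-(j.1 : ℝ) * (s - ε) * p)) *
        ⨍⁻ y, ENNReal.ofReal (g j.1 y ^ p) ∂ν := by
    simp only [laverage, gradSum]
    have hmj : ∀ j : {j : ℤ // k - 2 ≤ j}, AEMeasurable (fun y ↦
        ENNReal.ofReal ((2 : ℝ) ^ (-(j.1 : ℝ) * (s - ε) * p)) * ENNReal.ofReal (g j.1 y ^ p))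
        ((ν Set.univ)⁻¹ • ν) := fun j ↦ ((hm j.1).const_mul _).aemeasurable
    rw [lintegral_tsum hmj]
    exact tsum_congr fun j ↦ lintegral_const_mul _ (hm j.1)
  rw [hsplit, ENNReal.ofReal_mul (Real.rpow_nonneg hb.le p)]
  refine (ENNReal.tsum_le_tsum hterm).trans ?_
  rw [ENNReal.tsum_mul_left]
  exact mul_le_mul' le_rfl (tsum_ofReal_two_rpow_le hθ k)

theorem statement11 [MetricSpace X] [MeasurableSpace X] (μ : Measure X)
    (c_d : ℝ≥0∞) (hdoub : IsDoubling μ c_d) (Q : ℝ) (hQ : 1 < Q)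
    (c_Q : ℝ) (hcQ : 0 < c_Q) (hdim : DimLowerBound μ c_Q Q)
    (s p ε ε' : ℝ) (hs : 0 < s) (hp : 0 < p) (hsp : s * p < Q)
    (hε : 0 < ε) (hεε' : ε < ε') (hε's : ε' < s) :
    ∃ C : ℝ, 0 < C ∧ ∀ (u : X → ℝ) (g : ℤ → X → ℝ), Measurable u →
      IsFracHajlaszGradient μ s u g → ∀ (x : X) (k : ℤ),
      ⨅ c : ℝ, (⨍⁻ y in ball x ((2 : ℝ) ^ (-k)),
            ENNReal.ofReal (|u y - c| ^ (Q * p / (Q - ε * p))) ∂μ) ^ ((Q - ε * p) / (Q * p)) ≤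
        ENNReal.ofReal C * ENNReal.ofReal ((2 : ℝ) ^ (-(k : ℝ) * ε')) *
          ∑' j : {j : ℤ // k - 2 ≤ j},
            ENNReal.ofReal ((2 : ℝ) ^ (-(j.1 : ℝ) * (s - ε'))) *
              (⨍⁻ y in ball x ((2 : ℝ) ^ (-k + 1)),
                ENNReal.ofReal (g j.1 y ^ p) ∂μ) ^ (1 / p) := by
  obtain ⟨C, hC, hSP⟩ := exists_sobolev_poincare (zero_lt_one.trans hQ) hcQ hdim hp hε
    ((mul_le_mul_of_nonneg_right (hεε'.trans hε's).le hp.le).trans_lt hsp)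
  have h2 : (0 : ℝ) < 2 := two_pos
  set θ : ℝ := (ε' - ε) * p with hθdef
  have hθ : 0 < θ := mul_pos (by linarith) hp
  set Z : ℝ := (2 : ℝ) ^ (2 * θ) * (1 - (2 : ℝ) ^ (-θ))⁻¹
  have hZ : 0 < Z := mul_pos (by positivity)
    (inv_pos.2 (sub_pos.2 (Real.rpow_lt_one_of_one_lt_of_neg one_lt_two (by linarith))))
  refine ⟨C * Z ^ (1 / p), by positivity, ?_⟩
  rintro u g hu ⟨hgm, hg0, E, hE, hgu⟩ x k
  set S : ℝ≥0∞ := ∑' j : {j : ℤ // k - 2 ≤ j},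
    ENNReal.ofReal ((2 : ℝ) ^ (-(j.1 : ℝ) * (s - ε'))) *
      (⨍⁻ y in ball x ((2 : ℝ) ^ (-k + 1)), ENNReal.ofReal (g j.1 y ^ p) ∂μ) ^ (1 / p)
  have hcpos : ENNReal.ofReal (C * Z ^ (1 / p)) *
      ENNReal.ofReal ((2 : ℝ) ^ (-(k : ℝ) * ε')) ≠ 0 :=
    mul_ne_zero (ENNReal.ofReal_pos.2 (by positivity)).ne'
      (ENNReal.ofReal_pos.2 (by positivity)).ne'
  have hctop : ENNReal.ofReal (C * Z ^ (1 / p)) *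
      ENNReal.ofReal ((2 : ℝ) ^ (-(k : ℝ) * ε')) ≠ ∞ :=
    ENNReal.mul_ne_top ENNReal.ofReal_ne_top ENNReal.ofReal_ne_top
  have key : ∀ b : ℝ, 0 < b → S ≤ ENNReal.ofReal b →
      ⨅ c : ℝ, (⨍⁻ y in ball x ((2 : ℝ) ^ (-k)),
            ENNReal.ofReal (|u y - c| ^ (Q * p / (Q - ε * p))) ∂μ) ^ ((Q - ε * p) / (Q * p)) ≤
        ENNReal.ofReal (C * Z ^ (1 / p)) * ENNReal.ofReal ((2 : ℝ) ^ (-(k : ℝ) * ε')) *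
          ENNReal.ofReal b := by
    intro b hb hSb
    have hR : (2 : ℝ) ^ (-k + 1) = 2 * (2 : ℝ) ^ (-k) := by
      rw [zpow_add₀ h2.ne', zpow_one, mul_comm]
    have havg := laverage_gradSum_le (ε := ε) hgm hp hεε' hb hSb
    rw [hR] at havg
    have hFm : Measurable (gradSum g (s - ε) p k) :=
      Measurable.tsum fun j ↦ (((hgm j.1).pow_const p).ennreal_ofReal).const_mul _
    refine (hSP u (gradSum g (s - ε) p k) E x ((2 : ℝ) ^ (-k)) _ hu hFm hE (by positivity)
      (by positivity) ?_ havg).trans (le_of_eq ?_)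
    · intro y hy hyE z hz hzE t ht hyt hzt
      refine abs_sub_le_of_gradSum_le hg0 hgu hp (hεε'.trans hε's) hyE hzE ?_ ht hyt hzt
      have hR4 : (2 : ℝ) ^ (-k + 2) = 4 * (2 : ℝ) ^ (-k) := by
        rw [zpow_add₀ h2.ne', mul_comm]; norm_num
      rw [mem_ball] at hy hz
      linarith [dist_triangle_right y z x]
    · rw [← ENNReal.ofReal_mul (by positivity), ← ENNReal.ofReal_mul (by positivity)]
      congr 1
      have hb1 : (b ^ p * (Z * (2 : ℝ) ^ (-(k : ℝ) * θ))) ^ (1 / p) =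
          b * (Z ^ (1 / p) * (2 : ℝ) ^ (-(k : ℝ) * (ε' - ε))) := by
        rw [Real.mul_rpow (by positivity) (by positivity),
          Real.mul_rpow hZ.le (by positivity), ← Real.rpow_mul hb.le,
          ← Real.rpow_mul h2.le, mul_one_div_cancel hp.ne', Real.rpow_one, hθdef]
        congr 3
        field_simp
      have hk : ((2 : ℝ) ^ (-k)) ^ ε = (2 : ℝ) ^ (-(k : ℝ) * ε) := by
        rw [Real.rpow_mul h2.le, ← Int.cast_neg, Real.rpow_intCast]
      have hsum : (2 : ℝ) ^ (-(k : ℝ) * ε') =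
          (2 : ℝ) ^ (-(k : ℝ) * ε) * (2 : ℝ) ^ (-(k : ℝ) * (ε' - ε)) := by
        rw [← Real.rpow_add h2]; ring_nf
      rw [hb1, hk, hsum]
      ring
  rcases eq_or_ne S ∞ with hSt | hSt
  · rw [hSt, ENNReal.mul_top hcpos]
    exact le_top
  rw [mul_comm _ S, ← ENNReal.div_le_iff hcpos hctop]
  refine ENNReal.le_of_forall_pos_le_add fun η hη _ ↦ ?_
  rw [ENNReal.div_le_iff hcpos hctop, mul_comm _ (_ * _)]
  have hb : ENNReal.ofReal (S.toReal + η) = S + η := by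
    rw [ENNReal.ofReal_add ENNReal.toReal_nonneg η.coe_nonneg, ENNReal.ofReal_toReal hSt,
      ENNReal.ofReal_coe_nnreal]
  rw [← hb]
  exact key _ (by positivity) (hb ▸ le_self_add)

end FracMaximal
end
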